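/- arXiv:1008.3475 — 2 statements merged into one kernel-verified Lean document; each statement's English description precedes it below -/
import Mathlib

section
/- For every odd prime ℓ and every integer n ≥ 0, p̄(3ℓ²n) ≡ (ℓ − ℓ·(n/ℓ) + 1)·p̄(3n) − ℓ·p̄(3n/ℓ²) (mod 3), where (n/ℓ) denotes the Legendre symbol and p̄(3n/ℓ²) is taken to be 0 unless ℓ² divides 3n. -/
/-- Number of overpartitions of `n`: pairs consisting of a partition of some
`m ≤ n` into distinct parts (the overlined parts) and a partition of `n - m`. -/
def pbar (n : ℕ) : ℕ :=
  ∑ m ∈ Finset.range (n + 1),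
    (Nat.Partition.distincts m).card * Fintype.card (Nat.Partition (n - m))

section GaussFinite

variable {R : Type*} [CommRing R]

/-- The product `∏ (1 - x ^ (k + 1 + i)) / (1 + x ^ (k + 1 + i))` over `i < j`, where `u i` plays
the role of `1 / (1 + x ^ (i + 1))`. -/
def gaussProd (x : R) (u : ℕ → R) (k j : ℕ) : R :=
  ∏ i ∈ Finset.range j, ((1 - x ^ (k + 1 + i)) * u (k + i))

/-- The partial sums of the remainder series in the iterated expansion of `gaussProd`. -/
def gaussTail (x : R) (u : ℕ → R) (k J : ℕ) : R :=
  ∑ j ∈ Finset.range J, x ^ ((k + 1) * j) * gaussProd x u k j * u (k + j)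

theorem gaussTail_succ {x : R} {u v : ℕ → R} (hu : ∀ i, (1 + x ^ (i + 1)) * u i = 1)
    (hv : ∀ i, (1 - x ^ (i + 1)) * v i = 1) (k J : ℕ) :
    gaussTail x u k (J + 1) = 1 - x ^ ((k + 1) * (J + 1)) * gaussProd x u k (J + 1) * v k
      - x ^ (2 * k + 3) * gaussTail x u (k + 1) J := by
  induction J with
  | zero =>
    simp only [gaussTail, gaussProd, zero_add, Finset.sum_range_one, Finset.prod_range_one,
      Finset.range_zero, Finset.prod_empty, Finset.sum_empty, mul_zero, pow_zero, mul_one, add_zero]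
    linear_combination hu k + x ^ (k + 1) * u k * hv k
  | succ J ih =>
    have h1 : gaussProd x u k (J + 1) = (1 - x ^ (k + 1)) * u k * gaussProd x u (k + 1) J := by
      simp only [gaussProd]
      rw [Finset.prod_range_succ', mul_comm]
      congr 1
      exact Finset.prod_congr rfl fun i _ ↦ by
        rw [show k + 1 + (i + 1) = k + 1 + 1 + i by ring, show k + (i + 1) = k + 1 + i by ring]
    have h2 : gaussProd x u k (J + 1 + 1) =
        gaussProd x u k (J + 1) * ((1 - x ^ (k + J + 2)) * u (k + J + 1)) := by
      rw [gaussProd, Finset.prod_range_succ, ← gaussProd]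
      rw [show k + 1 + (J + 1) = k + J + 2 by ring, show k + (J + 1) = k + J + 1 by ring]
    have hT : ∀ k J, gaussTail x u k (J + 1) =
        gaussTail x u k J + x ^ ((k + 1) * J) * gaussProd x u k J * u (k + J) :=
      fun k J ↦ Finset.sum_range_succ _ _
    rw [hT k (J + 1), ih, hT (k + 1) J, h2, h1, show k + (J + 1) = k + J + 1 by ring,
      show k + 1 + J = k + J + 1 by ring]
    generalize gaussProd x u (k + 1) J = b
    have e1 : x ^ ((k + 1) * (J + 1 + 1)) = x ^ ((k + 1) * (J + 1)) * x ^ (k + 1) := by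
      rw [← pow_add]; congr 1
    have e2 : x ^ (2 * k + 3) * x ^ ((k + 1 + 1) * J) =
        x ^ ((k + 1) * (J + 1)) * x ^ (k + J + 2) := by
      rw [← pow_add, ← pow_add]; congr 1; ring
    have hw := hu (k + J + 1)
    have hk := hu k
    have hvk := hv k
    rw [show k + J + 1 + 1 = k + J + 2 by ring] at hw
    rw [e1]
    generalize x ^ ((k + 1) * (J + 1)) = c at *
    generalize x ^ (k + J + 2) = y at *
    generalize u (k + J + 1) = w at *
    generalize u k = u at *
    generalize v k = v at *
    generalize x ^ (k + 1) = a at *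
    linear_combination (b * w) * e2 + c * b * (1 - a * u) * hw - c * b * (1 - w) * hk
      - c * b * u * (1 - a * (1 - y) * w) * hvk

theorem gaussProd_zero_eq {x : R} {u : ℕ → R} (hu : ∀ i, (1 + x ^ (i + 1)) * u i = 1) (N : ℕ) :
    gaussProd x u 0 N = 1 - 2 * x * gaussTail x u 0 N := by
  induction N with
  | zero => simp [gaussProd, gaussTail]
  | succ N ih =>
    have h1 : gaussTail x u 0 (N + 1) = gaussTail x u 0 N + x ^ N * gaussProd x u 0 N * u N := by
      simp [gaussTail, Finset.sum_range_succ]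
    have h2 : gaussProd x u 0 (N + 1) = gaussProd x u 0 N * ((1 - x ^ (N + 1)) * u N) := by
      simp [gaussProd, Finset.prod_range_succ, add_comm]
    rw [h1, h2]
    linear_combination ih + gaussProd x u 0 N * hu N

theorem gaussProd_zero_congr {x : R} {u v : ℕ → R} (hu : ∀ i, (1 + x ^ (i + 1)) * u i = 1)
    (hv : ∀ i, (1 - x ^ (i + 1)) * v i = 1) {m N : ℕ} (hm : m ≤ N) :
    x ^ (N + 1) ∣ gaussProd x u 0 N - (1 + 2 * ∑ s ∈ Finset.range m, (-1) ^ (s + 1) * x ^ (s + 1) ^ 2)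
      + 2 * (-1) ^ m * x ^ (m + 1) ^ 2 * gaussTail x u m (N - m) := by
  induction m with
  | zero =>
    rw [gaussProd_zero_eq hu]
    simp
  | succ m ih =>
    obtain ⟨d, hd⟩ : ∃ d, N = m + 1 + d := ⟨N - (m + 1), by omega⟩
    have ih := ih (by omega)
    subst hd
    rw [show m + 1 + d - m = d + 1 by omega, gaussTail_succ hu hv] at ih
    rw [show m + 1 + d - (m + 1) = d by omega, Finset.sum_range_succ]
    have h3 : x ^ (m + 1 + d + 1) ∣ 2 * (-1) ^ m * x ^ (m + 1) ^ 2 *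
        (x ^ ((m + 1) * (d + 1)) * gaussProd x u m (d + 1) * v m) := by
      have : x ^ (m + 1) ^ 2 * x ^ ((m + 1) * (d + 1)) = x ^ (m + 1 + d + 1) *
          x ^ (m * (m + 1 + d + 1)) := by
        rw [← pow_add, ← pow_add]; congr 1; ring
      exact ⟨2 * (-1) ^ m * x ^ (m * (m + 1 + d + 1)) * gaussProd x u m (d + 1) * v m, by
        linear_combination (2 * (-1) ^ m * gaussProd x u m (d + 1) * v m) * this⟩
    convert dvd_add ih h3 using 1
    have : x ^ (m + 1 + 1) ^ 2 = x ^ (m + 1) ^ 2 * x ^ (2 * m + 3) := by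
      rw [← pow_add]; congr 1; ring
    rw [this]
    ring

end GaussFinite

section GeneratingFunction

open PowerSeries Finset
open scoped PowerSeries.WithPiTopology

variable (R : Type*) [CommRing R]

/-- The truncation `∑ (-1) ^ x * X ^ (x ^ 2)` over `|x| ≤ N` of the theta series `φ(-q)`. -/
noncomputable def thetaPartial (N : ℕ) : R⟦X⟧ :=
  ∑ x ∈ Icc (-(N : ℤ)) N, (-1) ^ x.natAbs * X ^ (x.natAbs ^ 2)

theorem thetaPartial_eq (N : ℕ) : thetaPartial R N =
    1 + 2 * ∑ s ∈ range N, (-1) ^ (s + 1) * X ^ (s + 1) ^ 2 := by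
  induction N with
  | zero => simp [thetaPartial]
  | succ N ih =>
    have h : Icc (-((N + 1 : ℕ) : ℤ)) ((N + 1 : ℕ) : ℤ) =
        insert ((N + 1 : ℕ) : ℤ) (insert (-((N + 1 : ℕ) : ℤ)) (Icc (-(N : ℤ)) N)) := by
      ext x
      simp only [mem_Icc, mem_insert]
      push_cast
      omega
    rw [thetaPartial, h, sum_insert (by simp only [mem_insert, mem_Icc]; push_cast; omega),
      sum_insert (by simp only [mem_Icc]; push_cast; omega), Int.natAbs_neg, Int.natAbs_natCast,
      sum_range_succ, ← thetaPartial, ih]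
    ring

variable {R}

theorem X_pow_dvd_sub_prod_range {f : ℕ → R⟦X⟧} {g : R⟦X⟧} (N : ℕ)
    (hf : ∀ i, X ^ (i + 1) ∣ f i - 1)
    (h : letI : TopologicalSpace R := ⊥; HasProd f g) :
    X ^ (N + 1) ∣ g - ∏ i ∈ range N, f i := by
  let : TopologicalSpace R := ⊥
  have : DiscreteTopology R := ⟨rfl⟩
  have hstable : ∀ M, X ^ (N + 1) ∣ (∏ i ∈ range (N + M), f i) - ∏ i ∈ range N, f i := by
    intro M
    induction M with
    | zero => simp
    | succ M ih =>
      rw [← add_assoc, prod_range_succ]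
      have h1 : X ^ (N + 1) ∣ f (N + M) - 1 := (pow_dvd_pow X (by omega)).trans (hf (N + M))
      convert dvd_add ih (h1.mul_left (∏ i ∈ range (N + M), f i)) using 1
      ring
  rw [X_pow_dvd_iff]
  intro m hm
  have ht := (WithPiTopology.tendsto_iff_coeff_tendsto R _ _ _).1 h.tendsto_prod_nat m
  rw [nhds_discrete, Filter.tendsto_pure, Filter.eventually_atTop] at ht
  obtain ⟨M, hM⟩ := ht
  have h2 := hM (N + M) (by omega)
  have h3 := X_pow_dvd_iff.1 (hstable M) m hm
  rw [map_sub] at h3 ⊢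
  rw [← h2, h3]

variable (R)

/-- The generating function of the number of overpartitions. -/
noncomputable def pbarSeries : R⟦X⟧ := PowerSeries.mk fun n ↦ (pbar n : R)

theorem pbarSeries_eq_mul : pbarSeries R =
    PowerSeries.mk (fun n ↦ ((Nat.Partition.countRestricted n 2).card : R)) *
      PowerSeries.mk (fun n ↦ ((Nat.Partition.restricted n fun _ ↦ True).card : R)) := by
  ext n
  rw [pbarSeries, coeff_mk, coeff_mul, Nat.sum_antidiagonal_eq_sum_range_succ_mk, pbar]
  simp [Nat.Partition.countRestricted_two, Nat.Partition.restricted]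

/-- Gauss's identity, in truncated form: the theta series `φ(-q)` is inverse to the generating
function of the number of overpartitions. -/
theorem X_pow_dvd_pbarSeries_mul_thetaPartial (N : ℕ) :
    X ^ (N + 1) ∣ pbarSeries R * thetaPartial R N - 1 := by
  let : TopologicalSpace R := ⊥
  have : DiscreteTopology R := ⟨rfl⟩
  have hgeom (i : ℕ) : (1 - X ^ (i + 1) : R⟦X⟧) * ∑' j : ℕ, (X ^ (i + 1)) ^ j = 1 := by
    rw [mul_comm]
    exact WithPiTopology.tsum_pow_mul_one_sub_of_constantCoeff_eq_zero (by simp)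
  set v : ℕ → R⟦X⟧ := fun i ↦ ∑' j : ℕ, (X ^ (i + 1)) ^ j
  have hunit (i : ℕ) : ∃ u : R⟦X⟧, (1 + X ^ (i + 1)) * u = 1 :=
    (isUnit_iff_exists_inv.1 (isUnit_iff_constantCoeff.2 (by simp)))
  choose u hu using hunit
  have hD : X ^ (N + 1) ∣ PowerSeries.mk
      (fun n ↦ ((Nat.Partition.countRestricted n 2).card : R)) -
      ∏ i ∈ range N, (1 + X ^ (i + 1)) := by
    refine X_pow_dvd_sub_prod_range N (by simp) ?_
    have h : (fun i ↦ ∑ j ∈ range 2, (X : R⟦X⟧) ^ ((i + 1) * j)) = fun i ↦ 1 + X ^ (i + 1) := by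
      ext1 i
      rw [sum_range_succ, sum_range_one, mul_zero, pow_zero, mul_one]
    exact h ▸ Nat.Partition.hasProd_powerSeriesMk_card_countRestricted R two_pos
  have hQ : X ^ (N + 1) ∣ PowerSeries.mk
      (fun n ↦ ((Nat.Partition.restricted n fun _ ↦ True).card : R)) - ∏ i ∈ range N, v i := by
    refine X_pow_dvd_sub_prod_range N (fun i ↦ ⟨v i, by linear_combination hgeom i⟩) ?_
    have h := Nat.Partition.hasProd_powerSeriesMk_card_restricted R (fun _ ↦ True)
    simpa [v, pow_mul] using h
  have hA := gaussProd_zero_congr hu hgeom le_rfl (N := N)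
  rw [← thetaPartial_eq, Nat.sub_self] at hA
  have hprod : (∏ i ∈ range N, (1 + X ^ (i + 1))) * (∏ i ∈ range N, v i) *
      gaussProd X u 0 N = 1 := by
    rw [gaussProd, ← prod_mul_distrib, ← prod_mul_distrib]
    refine prod_eq_one fun i _ ↦ ?_
    simp only [zero_add]
    rw [add_comm 1 i]
    linear_combination hgeom i * ((1 + X ^ (i + 1)) * u i) + hu i
  rw [pbarSeries_eq_mul]
  obtain ⟨d, hd⟩ := hD
  obtain ⟨e, he⟩ := hQ
  obtain ⟨c, hc⟩ := hA
  simp only [gaussTail, range_zero, sum_empty, mul_zero, add_zero] at hc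
  rw [sub_eq_iff_eq_add] at hd he
  rw [hd, he]
  exact ⟨d * (X ^ (N + 1) * e + ∏ i ∈ range N, v i) * thetaPartial R N +
    (∏ i ∈ range N, (1 + X ^ (i + 1))) * e * thetaPartial R N -
    (∏ i ∈ range N, (1 + X ^ (i + 1))) * (∏ i ∈ range N, v i) * c, by
    linear_combination hprod - (∏ i ∈ range N, (1 + X ^ (i + 1))) * (∏ i ∈ range N, v i) * hc⟩

end GeneratingFunction

section ModThree

open PowerSeries Finset

/-- The integer points `(x, y, z)` with `x ^ 2 + y ^ 2 + 3 * z ^ 2 = n`. -/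
noncomputable def ternaryReps (n : ℕ) : Finset (ℤ × ℤ × ℤ) :=
  (Icc (-(n : ℤ)) n ×ˢ Icc (-(n : ℤ)) n ×ˢ Icc (-(n : ℤ)) n).filter
    fun v ↦ v.1 ^ 2 + v.2.1 ^ 2 + 3 * v.2.2 ^ 2 = n

theorem abs_le_of_sq_le {x : ℤ} {n : ℕ} (h : x ^ 2 ≤ n) : -(n : ℤ) ≤ x ∧ x ≤ n :=
  abs_le.1 ((Int.natCast_natAbs x ▸ by exact_mod_cast Nat.le_self_pow two_ne_zero x.natAbs :
    |x| ≤ ((x.natAbs ^ 2 : ℕ) : ℤ)).trans (by simpa using h))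

theorem mem_ternaryReps {n : ℕ} {v : ℤ × ℤ × ℤ} :
    v ∈ ternaryReps n ↔ v.1 ^ 2 + v.2.1 ^ 2 + 3 * v.2.2 ^ 2 = n := by
  simp only [ternaryReps, mem_filter, mem_product, mem_Icc, and_iff_right_iff_imp]
  intro h
  have := sq_nonneg v.1
  have := sq_nonneg v.2.1
  have := sq_nonneg v.2.2
  exact ⟨abs_le_of_sq_le (by linarith), abs_le_of_sq_le (by linarith),
    abs_le_of_sq_le (by linarith)⟩

theorem coeff_neg_one_pow_mul_X_pow (a e m : ℕ) :
    coeff m ((-1) ^ a * X ^ e : (ZMod 3)⟦X⟧) = if m = e then (-1) ^ a else 0 := by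
  have : ((-1) ^ a : (ZMod 3)⟦X⟧) = C ((-1) ^ a) := by simp
  rw [this, coeff_C_mul, coeff_X_pow]
  simp

theorem coeff_pow_three_mul (f g h : (ZMod 3)⟦X⟧) (n : ℕ)
    (hgh : ∀ m ≤ n, coeff (3 * m) g = coeff m h) :
    coeff (3 * n) (f ^ 3 * g) = coeff n (f * h) := by
  have hf : f ^ 3 = f.expand 3 three_ne_zero := by
    have := MvPowerSeries.map_frobenius_expand 3 three_ne_zero (f := f)
    rw [ZMod.frobenius_zmod] at this
    rw [← this]
    exact (congrArg (· (f.expand 3 three_ne_zero)) MvPowerSeries.map_id).symm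
  rw [hf, coeff_mul, coeff_mul]
  let φ : ℕ × ℕ → ℕ × ℕ := fun p ↦ (3 * p.1, 3 * p.2)
  have hφ : Function.Injective φ := fun p q h ↦ by
    simp only [φ, Prod.mk.injEq] at h
    ext <;> omega
  rw [← sum_subset (s₁ := (antidiagonal n).image φ), sum_image hφ.injOn]
  · refine sum_congr rfl fun p hp ↦ ?_
    rw [HasAntidiagonal.mem_antidiagonal] at hp
    simp only [φ]
    rw [coeff_expand_mul, hgh _ (by omega)]
  · intro p hp
    obtain ⟨q, hq, rfl⟩ := mem_image.1 hp
    rw [HasAntidiagonal.mem_antidiagonal] at hq ⊢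
    simp only [φ]
    omega
  · intro p hp hp'
    rw [HasAntidiagonal.mem_antidiagonal] at hp
    rw [coeff_expand_of_not_dvd, zero_mul]
    rintro ⟨i, hi⟩
    refine hp' (mem_image.2 ⟨(i, n - i), by rw [HasAntidiagonal.mem_antidiagonal]; omega, ?_⟩)
    ext <;> simp only [φ] <;> omega

theorem thetaPartial_pow_three (N : ℕ) : thetaPartial (ZMod 3) N ^ 3 =
    ∑ x ∈ Icc (-(N : ℤ)) N, (-1) ^ x.natAbs * X ^ (3 * x.natAbs ^ 2) := by
  have : CharP (ZMod 3)⟦X⟧ 3 := charP_of_injective_ringHom (C_injective (R := ZMod 3)) 3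
  rw [thetaPartial, sum_pow_char]
  refine sum_congr rfl fun x _ ↦ ?_
  rw [mul_pow, ← pow_mul, ← pow_mul, mul_comm _ 3, mul_comm _ 3, pow_mul (-1)]
  norm_num

theorem dvd_of_three_dvd_sq_add_sq {x y : ℤ} (h : 3 ∣ x ^ 2 + y ^ 2) : 3 ∣ x ∧ 3 ∣ y := by
  have key : ∀ a b : ZMod 3, a ^ 2 + b ^ 2 = 0 → a = 0 ∧ b = 0 := by decide
  have := key x y (by exact_mod_cast (ZMod.intCast_zmod_eq_zero_iff_dvd _ 3).2 h)
  exact ⟨(ZMod.intCast_zmod_eq_zero_iff_dvd _ 3).1 this.1,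
    (ZMod.intCast_zmod_eq_zero_iff_dvd _ 3).1 this.2⟩

theorem coeff_thetaPartial_sq {m N : ℕ} (h : 3 * m ≤ N) :
    coeff (3 * m) (thetaPartial (ZMod 3) N ^ 2) = coeff m (thetaPartial (ZMod 3) N ^ 6) := by
  rw [show 6 = 3 * 2 by rfl, pow_mul, thetaPartial_pow_three, thetaPartial, sq, sq, sum_mul_sum,
    sum_mul_sum, ← sum_product', ← sum_product', map_sum, map_sum]
  have e1 (e₁ e₂ a₁ a₂ : ℕ) : ((-1) ^ a₁ * X ^ e₁ * ((-1) ^ a₂ * X ^ e₂) : (ZMod 3)⟦X⟧) =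
      (-1) ^ (a₁ + a₂) * X ^ (e₁ + e₂) := by ring
  simp only [e1, coeff_neg_one_pow_mul_X_pow, ← sum_filter]
  symm
  refine sum_nbij' (fun p ↦ (3 * p.1, 3 * p.2)) (fun p ↦ (p.1 / 3, p.2 / 3)) ?_ ?_ ?_ ?_ ?_
  · rintro ⟨x, y⟩ hp
    simp only [mem_filter, mem_product, mem_Icc] at hp ⊢
    have h1 : (m : ℤ) = 3 * x ^ 2 + 3 * y ^ 2 := by
      rw [hp.2]; push_cast; simp
    have hx : (3 * x) ^ 2 ≤ (N : ℤ) := by nlinarith [sq_nonneg y]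
    have hy : (3 * y) ^ 2 ≤ (N : ℤ) := by nlinarith [sq_nonneg x]
    refine ⟨⟨abs_le_of_sq_le hx, abs_le_of_sq_le hy⟩, ?_⟩
    zify
    rw [sq_abs, sq_abs, h1]; ring
  · rintro ⟨x, y⟩ hp
    simp only [mem_filter, mem_product, mem_Icc] at hp ⊢
    have h1 : (3 * m : ℤ) = x ^ 2 + y ^ 2 := by
      zify at hp; simpa using hp.2
    obtain ⟨⟨a, rfl⟩, ⟨b, rfl⟩⟩ := dvd_of_three_dvd_sq_add_sq ⟨_, h1.symm⟩
    rw [Int.mul_ediv_cancel_left _ three_ne_zero, Int.mul_ediv_cancel_left _ three_ne_zero]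
    refine ⟨by omega, ?_⟩
    zify
    rw [sq_abs, sq_abs]
    linarith
  · rintro ⟨x, y⟩ hp
    simp
  · rintro ⟨x, y⟩ hp
    simp only [mem_filter, mem_product, mem_Icc] at hp
    have h1 : (3 * m : ℤ) = x ^ 2 + y ^ 2 := by
      zify at hp; simpa using hp.2
    obtain ⟨⟨a, rfl⟩, ⟨b, rfl⟩⟩ := dvd_of_three_dvd_sq_add_sq ⟨_, h1.symm⟩
    simp
  · rintro ⟨x, y⟩ hp
    simp only [Int.natAbs_mul]
    rw [← mul_add, pow_mul]
    norm_num

theorem coeff_thetaPartial_pow_five {n N : ℕ} (h : n ≤ N) :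
    coeff n (thetaPartial (ZMod 3) N ^ 5) = (-1) ^ n * ((ternaryReps n).card : ZMod 3) := by
  rw [show 5 = 2 + 3 by rfl, pow_add, thetaPartial_pow_three, thetaPartial, sq, mul_assoc,
    sum_mul_sum, sum_mul_sum]
  simp only [mul_sum]
  simp only [← sum_product', map_sum]
  have e1 (e₁ e₂ e₃ a₁ a₂ a₃ : ℕ) : ((-1) ^ a₁ * X ^ e₁ * ((-1) ^ a₂ * X ^ e₂ *
      ((-1) ^ a₃ * X ^ e₃)) : (ZMod 3)⟦X⟧) = (-1) ^ (a₁ + a₂ + a₃) * X ^ (e₁ + e₂ + e₃) := by ring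
  simp only [e1, coeff_neg_one_pow_mul_X_pow, ← sum_filter]
  have e2 : {a ∈ Icc (-(N : ℤ)) N ×ˢ Icc (-(N : ℤ)) N ×ˢ Icc (-(N : ℤ)) N |
      n = a.1.natAbs ^ 2 + a.2.1.natAbs ^ 2 + 3 * a.2.2.natAbs ^ 2} = ternaryReps n := by
    ext ⟨x, y, z⟩
    rw [mem_ternaryReps, mem_filter]
    zify
    simp only [sq_abs, mem_product, mem_Icc]
    constructor
    · rintro ⟨-, hn⟩
      exact hn.symm
    · intro hn
      have := sq_nonneg x
      have := sq_nonneg y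
      have := sq_nonneg z
      exact ⟨⟨abs_le_of_sq_le (by linarith), abs_le_of_sq_le (by linarith),
        abs_le_of_sq_le (by linarith)⟩, hn.symm⟩
  rw [e2, mul_comm, ← nsmul_eq_mul]
  refine sum_eq_card_nsmul fun v hv ↦ ?_
  rw [mem_ternaryReps] at hv
  have hn : n = v.1.natAbs ^ 2 + v.2.1.natAbs ^ 2 + 3 * v.2.2.natAbs ^ 2 := by
    zify
    simpa using hv.symm
  refine neg_one_pow_congr ?_
  rw [hn]
  simp [parity_simps]

theorem pbar_three_mul (n : ℕ) :
    (pbar (3 * n) : ZMod 3) = (-1) ^ n * ((ternaryReps n).card : ZMod 3) := by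
  set S := thetaPartial (ZMod 3) (3 * n)
  set G := pbarSeries (ZMod 3)
  obtain ⟨c, hc⟩ := X_pow_dvd_pbarSeries_mul_thetaPartial (ZMod 3) (3 * n)
  change G * S - 1 = _ at hc
  have hcoeff {m : ℕ} (hm : m ≤ 3 * n) (f : (ZMod 3)⟦X⟧) :
      coeff m (f * (X ^ (3 * n + 1) * c)) = 0 := by
    rw [mul_left_comm]
    exact X_pow_dvd_iff.1 (dvd_mul_right _ _) m (by omega)
  have h1 : coeff (3 * n) G = coeff (3 * n) (G ^ 3 * S ^ 2) := by
    have : G ^ 3 * S ^ 2 = G + G * (G * S + 1) * (X ^ (3 * n + 1) * c) := by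
      rw [← hc]; ring
    rw [this, map_add, hcoeff le_rfl, add_zero]
  have h2 : coeff n (G * S ^ 6) = coeff n (S ^ 5) := by
    have : G * S ^ 6 = S ^ 5 + S ^ 5 * (X ^ (3 * n + 1) * c) := by
      rw [← hc]; ring
    rw [this, map_add, hcoeff (by omega), add_zero]
  have h3 : (pbar (3 * n) : ZMod 3) = coeff (3 * n) G := by simp [G, pbarSeries]
  rw [h3, h1, coeff_pow_three_mul _ _ (S ^ 6) _ fun m hm ↦ coeff_thetaPartial_sq (by omega), h2,
    coeff_thetaPartial_pow_five (by omega)]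

end ModThree

section QuaternionOrder

open scoped Quaternion

/-- The maximal order of discriminant `3` in the rational quaternion algebra `(-1, -3)`: it has
basis `1, ω, j, ωj` with `ω ^ 2 = ω - 1`, `j ^ 2 = -1`. -/
abbrev QuatOrder : Type := ℍ[ℤ, -1, 1, -1]

namespace QuatOrder

/-- The reduced norm. -/
def nrm (q : QuatOrder) : ℤ :=
  q.re ^ 2 + q.re * q.imI + q.imI ^ 2 + q.imJ ^ 2 + q.imJ * q.imK + q.imK ^ 2

theorem nrm_mul (p q : QuatOrder) : nrm (p * q) = nrm p * nrm q := by
  simp only [nrm, QuaternionAlgebra.re_mul, QuaternionAlgebra.imI_mul, QuaternionAlgebra.imJ_mul,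
    QuaternionAlgebra.imK_mul]
  ring

theorem star_mul_self_eq (q : QuatOrder) : star q * q = ((nrm q : ℤ) : QuatOrder) := by
  obtain ⟨n, hn⟩ : ∃ n, nrm q = n := ⟨_, rfl⟩
  rw [hn]
  unfold nrm at hn
  ext <;> simp <;> first | linear_combination hn | ring

theorem mul_star_self_eq (q : QuatOrder) : q * star q = ((nrm q : ℤ) : QuatOrder) := by
  obtain ⟨n, hn⟩ : ∃ n, nrm q = n := ⟨_, rfl⟩
  rw [hn]
  unfold nrm at hn
  ext <;> simp <;> first | linear_combination hn | ring

theorem nrm_star (q : QuatOrder) : nrm (star q) = nrm q := by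
  simp [nrm]; ring

theorem nrm_nonneg (q : QuatOrder) : 0 ≤ nrm q := by
  unfold nrm
  nlinarith [sq_nonneg (q.re + q.imI), sq_nonneg q.re, sq_nonneg q.imI,
    sq_nonneg (q.imJ + q.imK), sq_nonneg q.imJ, sq_nonneg q.imK]

theorem nrm_eq_zero {q : QuatOrder} : nrm q = 0 ↔ q = 0 := by
  refine ⟨fun h ↦ ?_, fun h ↦ by simp [h, nrm]⟩
  unfold nrm at h
  have h1 : q.re = 0 := by
    nlinarith [sq_nonneg (q.re + q.imI), sq_nonneg q.re, sq_nonneg q.imI,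
      sq_nonneg (q.imJ + q.imK), sq_nonneg q.imJ, sq_nonneg q.imK]
  have h2 : q.imI = 0 := by
    nlinarith [sq_nonneg (q.re + q.imI), sq_nonneg q.re, sq_nonneg q.imI,
      sq_nonneg (q.imJ + q.imK), sq_nonneg q.imJ, sq_nonneg q.imK]
  have h3 : q.imJ = 0 := by
    nlinarith [sq_nonneg (q.re + q.imI), sq_nonneg q.re, sq_nonneg q.imI,
      sq_nonneg (q.imJ + q.imK), sq_nonneg q.imJ, sq_nonneg q.imK]
  have h4 : q.imK = 0 := by
    nlinarith [sq_nonneg (q.re + q.imI), sq_nonneg q.re, sq_nonneg q.imI,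
      sq_nonneg (q.imJ + q.imK), sq_nonneg q.imJ, sq_nonneg q.imK]
  ext <;> simpa

/-- In an equilateral triangle of side `n` every point is within `n / √3` of a vertex. -/
theorem exists_triangle_vertex {l m k : ℤ} (hl : 0 ≤ l) (hm : 0 ≤ m) (hk : 0 ≤ k)
    (hpos : 0 < l + m + k) :
    3 * (l ^ 2 + l * m + m ^ 2) ≤ (l + m + k) ^ 2 ∨ 3 * (m ^ 2 + m * k + k ^ 2) ≤ (l + m + k) ^ 2 ∨
      3 * (k ^ 2 + k * l + l ^ 2) ≤ (l + m + k) ^ 2 := by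
  by_contra! h
  obtain ⟨h1, h2, h3⟩ := h
  have e1 := mul_nonneg hk (sub_nonneg.2 (Int.add_one_le_of_lt h1))
  have e2 := mul_nonneg hl (sub_nonneg.2 (Int.add_one_le_of_lt h2))
  have e3 := mul_nonneg hm (sub_nonneg.2 (Int.add_one_le_of_lt h3))
  have e4 : (l + m + k) * (3 * (l * m + m * k + k * l)) ≤ (l + m + k) * (l + m + k) ^ 2 :=
    mul_le_mul_of_nonneg_left
      (by nlinarith [sq_nonneg (l - m), sq_nonneg (m - k), sq_nonneg (k - l)]) hpos.le
  nlinarith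

theorem exists_eisenstein_round (s t : ℤ) {n : ℤ} (hn : 0 < n) : ∃ p r : ℤ,
    3 * ((s - n * p) ^ 2 + (s - n * p) * (t - n * r) + (t - n * r) ^ 2) ≤ n ^ 2 := by
  have hs := Int.emod_add_mul_ediv s n
  have ht := Int.emod_add_mul_ediv t n
  have hs0 := Int.emod_nonneg s hn.ne'
  have ht0 := Int.emod_nonneg t hn.ne'
  have hs1 := Int.emod_lt_of_pos s hn
  have ht1 := Int.emod_lt_of_pos t hn
  set a := s % n
  set b := t % n
  set p := s / n
  set r := t / n
  rw [← hs, ← ht]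
  rcases le_total (a + b) n with h | h
  · rcases exists_triangle_vertex hs0 ht0 (sub_nonneg.2 h) (by linarith) with h | h | h
    · exact ⟨p, r, by linear_combination h⟩
    · exact ⟨p + 1, r, by linear_combination h⟩
    · exact ⟨p, r + 1, by linear_combination h⟩
  · rcases exists_triangle_vertex (sub_nonneg.2 hs1.le) (sub_nonneg.2 ht1.le) (sub_nonneg.2 h)
      (by linarith) with h | h | h
    · exact ⟨p + 1, r + 1, by linear_combination h⟩
    · exact ⟨p, r + 1, by linear_combination h⟩
    · exact ⟨p + 1, r, by linear_combination h⟩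

theorem exists_nrm_sub_mul_lt (a : QuatOrder) {b : QuatOrder} (hb : b ≠ 0) :
    ∃ q, nrm (a - b * q) < nrm b := by
  have hn : 0 < nrm b := (nrm_nonneg b).lt_of_ne fun h ↦ hb (nrm_eq_zero.1 h.symm)
  set n := nrm b with hndef
  set c := star b * a with hc
  obtain ⟨p₁, r₁, h₁⟩ := exists_eisenstein_round c.re c.imI hn
  obtain ⟨p₂, r₂, h₂⟩ := exists_eisenstein_round c.imJ c.imK hn
  refine ⟨⟨p₁, r₁, p₂, r₂⟩, ?_⟩
  have key : star b * (a - b * ⟨p₁, r₁, p₂, r₂⟩) = c - (n : QuatOrder) * ⟨p₁, r₁, p₂, r₂⟩ := by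
    rw [mul_sub, ← mul_assoc, star_mul_self_eq]
  have h3 : n * nrm (a - b * ⟨p₁, r₁, p₂, r₂⟩) = nrm (c - (n : QuatOrder) * ⟨p₁, r₁, p₂, r₂⟩) := by
    rw [← key, nrm_mul, nrm_star]
  have h4 : 3 * nrm (c - (n : QuatOrder) * ⟨p₁, r₁, p₂, r₂⟩) ≤ 2 * n ^ 2 := by
    simp [nrm]
    linarith
  by_contra! h
  have := mul_le_mul_of_nonneg_left h hn.le
  nlinarith

theorem dvd_nrm_add_mul (a q : QuatOrder) {n : ℤ} (h : n ∣ nrm a) :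
    n ∣ nrm (a + (n : QuatOrder) * q) := by
  obtain ⟨c, hc⟩ := h
  unfold nrm at hc
  refine ⟨c + 2 * a.re * q.re + n * q.re ^ 2 + a.re * q.imI + a.imI * q.re + n * q.re * q.imI
    + 2 * a.imI * q.imI + n * q.imI ^ 2 + 2 * a.imJ * q.imJ + n * q.imJ ^ 2 + a.imJ * q.imK
    + a.imK * q.imJ + n * q.imJ * q.imK + 2 * a.imK * q.imK + n * q.imK ^ 2, ?_⟩
  simp [nrm]
  linear_combination hc

theorem exists_nrm_eq_prime {l : ℕ} (hl : l.Prime) {v : QuatOrder} (hv : (l : ℤ) ∣ nrm v)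
    (hnd : ¬ ∃ w, v = ((l : ℤ) : QuatOrder) * w) : ∃ α δ, nrm α = l ∧ v = α * δ := by
  have hl0 : (0 : ℤ) < l := by exact_mod_cast hl.pos
  have hne : v * 0 + ((l : ℤ) : QuatOrder) * 1 ≠ 0 := by
    intro h
    have := congrArg QuaternionAlgebra.re h
    simp at this
    omega
  obtain ⟨α, ⟨hα0, p, q, hα⟩, hmin⟩ := (measure fun a ↦ (nrm a).toNat).wf.has_min
    {a : QuatOrder | a ≠ 0 ∧ ∃ p q, a = v * p + ((l : ℤ) : QuatOrder) * q}
    ⟨v * 0 + ((l : ℤ) : QuatOrder) * 1, hne, 0, 1, rfl⟩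
  have key : ∀ p' q', ∃ δ, v * p' + ((l : ℤ) : QuatOrder) * q' = α * δ := by
    intro p' q'
    obtain ⟨δ, hδ⟩ := exists_nrm_sub_mul_lt (v * p' + ((l : ℤ) : QuatOrder) * q') hα0
    refine ⟨δ, ?_⟩
    by_contra hne
    refine hmin (v * p' + ((l : ℤ) : QuatOrder) * q' - α * δ)
      ⟨sub_ne_zero.2 hne, p' - p * δ, q' - q * δ, ?_⟩ ?_
    · rw [hα]
      noncomm_ring
    · have := nrm_nonneg (v * p' + ((l : ℤ) : QuatOrder) * q' - α * δ)
      simp only [WellFoundedRelation.rel, InvImage]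
      change (nrm _).toNat < (nrm _).toNat
      omega
  obtain ⟨δ, hδ⟩ := key 1 0
  obtain ⟨β, hβ⟩ := key 0 1
  rw [mul_one, mul_zero, add_zero] at hδ
  rw [mul_one, mul_zero, zero_add] at hβ
  have hdvd : (l : ℤ) ∣ nrm α := by
    rw [hα]
    exact dvd_nrm_add_mul _ _ (by rw [nrm_mul]; exact hv.mul_right _)
  obtain ⟨k, hk⟩ := hdvd
  have hnn : (l : ℤ) * l = nrm α * nrm β := by
    rw [← nrm_mul, ← hβ]
    simp [nrm]
    ring
  have hkl : (l : ℤ) = k * nrm β := by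
    rw [hk, mul_assoc] at hnn
    exact mul_left_cancel₀ hl0.ne' hnn
  have hk0 : 0 ≤ k := by
    by_contra! h
    have := nrm_nonneg α
    nlinarith
  have hβ0 := nrm_nonneg β
  rcases (Nat.prime_iff_prime_int.1 hl).irreducible.isUnit_or_isUnit hkl with h | h
  · rcases Int.isUnit_iff.1 h with h | h
    · exact ⟨α, δ, by rw [hk, h, mul_one], hδ⟩
    · omega
  · have h1 : nrm β = 1 := by
      rcases Int.isUnit_iff.1 h with h | h <;> omega
    refine absurd ⟨star β * δ, ?_⟩ hnd
    rw [hβ, mul_assoc, ← mul_assoc β, mul_star_self_eq, h1, Int.cast_one, one_mul, hδ]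

/-- Multiplication by a power of `ω` makes `imI` and `imK` even. -/
theorem exists_even_associate {α δ : QuatOrder} (h : Odd (nrm α)) :
    ∃ α' δ', nrm α' = nrm α ∧ α' * δ' = α * δ ∧ Even α'.imI ∧ Even α'.imK := by
  have mulω : ∀ α δ : QuatOrder, ∃ α' δ', nrm α' = nrm α ∧ α' * δ' = α * δ ∧
      α'.imI = α.re + α.imI ∧ α'.imK = -α.imJ ∧ α'.re = -α.imI ∧ α'.imJ = α.imJ + α.imK := by
    intro α δ
    have hω : (⟨0, 1, 0, 0⟩ : QuatOrder) * ⟨1, -1, 0, 0⟩ = 1 := by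
      ext <;> simp
    refine ⟨α * ⟨0, 1, 0, 0⟩, ⟨1, -1, 0, 0⟩ * δ, ?_, ?_, ?_, ?_, ?_, ?_⟩
    · rw [nrm_mul]
      simp [nrm]
    · rw [mul_assoc, ← mul_assoc _ _ δ, hω, one_mul]
    all_goals simp
  unfold nrm at h
  by_cases h1 : Even α.imI ∧ Even α.imK
  · exact ⟨α, δ, rfl, rfl, h1.1, h1.2⟩
  obtain ⟨α₁, δ₁, hn₁, hm₁, a₁, b₁, c₁, d₁⟩ := mulω α δ
  obtain ⟨α₂, δ₂, hn₂, hm₂, a₂, b₂, c₂, d₂⟩ := mulω α₁ δ₁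
  by_cases h2 : Even α₁.imI ∧ Even α₁.imK
  · exact ⟨α₁, δ₁, hn₁, hm₁, h2.1, h2.2⟩
  refine ⟨α₂, δ₂, hn₂.trans hn₁, hm₂.trans hm₁, ?_⟩
  rw [a₂, b₂, c₁, a₁, d₁]
  rw [a₁, b₁] at h2
  revert h h1 h2
  rcases Int.even_or_odd α.re with hr | hr <;> rcases Int.even_or_odd α.imI with hi | hi <;>
  rcases Int.even_or_odd α.imJ with hj | hj <;> rcases Int.even_or_odd α.imK with hk | hk <;>
  simp [hr, hi, hj, hk, parity_simps, ← Int.not_even_iff_odd] <;> grind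

end QuatOrder

/-- A vector isotropic modulo `l` for `x ^ 2 + y ^ 2 + 3 * z ^ 2`, seen as the pure quaternion
`3 * z * i + x * j + y * k` with `i ^ 2 = -1`, `j ^ 2 = -3`, is, up to a factor `2`, a left multiple of an
integral quaternion of norm `l`. -/
theorem exists_quaternion_factor {l : ℕ} (hl : l.Prime) (h2 : l ≠ 2) (h3 : l ≠ 3) {x y z : ℤ}
    (hv : (l : ℤ) ∣ x ^ 2 + y ^ 2 + 3 * z ^ 2)
    (hnd : ¬ ((l : ℤ) ∣ x ∧ (l : ℤ) ∣ y ∧ (l : ℤ) ∣ z)) :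
    ∃ a b c d e f g h : ℤ, a ^ 2 + b ^ 2 + 3 * c ^ 2 + 3 * d ^ 2 = l ∧
      a * e - b * f - 3 * c * g - 3 * d * h = 0 ∧
      a * f + b * e + 3 * c * h - 3 * d * g = 6 * z ∧
      a * g + c * e - b * h + d * f = 2 * x ∧ a * h + d * e + b * g - c * f = 2 * y := by
  have hp := Nat.prime_iff_prime_int.1 hl
  have hodd : Odd (l : ℤ) := by exact_mod_cast hl.odd_of_ne_two h2
  have hcop : ∀ p : ℕ, p.Prime → l ≠ p → ∀ t : ℤ, (l : ℤ) ∣ p * t → (l : ℤ) ∣ t := by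
    intro p hp' hne t ht
    refine (hp.dvd_or_dvd ht).resolve_left fun h ↦ hne ?_
    exact (Nat.prime_dvd_prime_iff_eq hl hp').1 (Int.natCast_dvd_natCast.1 h)
  obtain ⟨α, δ, hα, hαδ⟩ := QuatOrder.exists_nrm_eq_prime hl (v := ⟨-x, 2 * x, 3 * z + y, -2 * y⟩)
    (by
      obtain ⟨k, hk⟩ := hv
      exact ⟨3 * k, by simp only [QuatOrder.nrm]; linear_combination 3 * hk⟩)
    (by
      rintro ⟨w, hw⟩
      have e1 := congrArg QuaternionAlgebra.re hw
      have e2 := congrArg QuaternionAlgebra.imJ hw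
      have e3 := congrArg QuaternionAlgebra.imK hw
      simp at e1 e2 e3
      have hy : (l : ℤ) ∣ y := hcop 2 Nat.prime_two h2 y ⟨-w.imK, by push_cast; linarith⟩
      refine hnd ⟨⟨-w.re, by linarith⟩, hy, hcop 3 Nat.prime_three h3 z ?_⟩
      obtain ⟨u, hu⟩ := hy
      exact ⟨w.imJ - u, by push_cast; linarith⟩)
  obtain ⟨α', δ', hn, hm, ⟨c, hc⟩, ⟨d, hd⟩⟩ := QuatOrder.exists_even_associate (δ := δ)
    (by rwa [hα] : Odd (QuatOrder.nrm α))
  rw [← hm] at hαδ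
  rw [hα] at hn
  have e1 := congrArg QuaternionAlgebra.re hαδ
  have e2 := congrArg QuaternionAlgebra.imI hαδ
  have e3 := congrArg QuaternionAlgebra.imJ hαδ
  have e4 := congrArg QuaternionAlgebra.imK hαδ
  simp [hc, hd] at e1 e2 e3 e4
  unfold QuatOrder.nrm at hn
  rw [hc, hd] at hn
  refine ⟨α'.re + c, α'.imJ + d, c, -d, 2 * δ'.re + δ'.imI, 2 * δ'.imJ + δ'.imK, δ'.imI, -δ'.imK,
    ?_, ?_, ?_, ?_, ?_⟩
  · linear_combination hn
  · linear_combination -2 * e1 - e2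
  · linear_combination -2 * e3 - e4
  · linear_combination - e2
  · linear_combination e4

end QuaternionOrder

section Rotation

open scoped Quaternion

/-- The quaternion algebra with `i ^ 2 = -1`, `j ^ 2 = -3` over the integers. -/
abbrev QuatLattice : Type := ℍ[ℤ, -1, 0, -3]

/-- The ternary form `x ^ 2 + y ^ 2 + 3 * z ^ 2`. -/
def ternaryForm (v : ℤ × ℤ × ℤ) : ℤ := v.1 ^ 2 + v.2.1 ^ 2 + 3 * v.2.2 ^ 2

/-- The bilinear form attached to `ternaryForm`. -/
def ternaryBilin (v w : ℤ × ℤ × ℤ) : ℤ := v.1 * w.1 + v.2.1 * w.2.1 + 3 * (v.2.2 * w.2.2)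

/-- All three coordinates are divisible by `l`. -/
def DvdVec (l : ℤ) (v : ℤ × ℤ × ℤ) : Prop := l ∣ v.1 ∧ l ∣ v.2.1 ∧ l ∣ v.2.2

/-- The two vectors are linearly dependent modulo `l`. -/
def CollinearMod (l : ℤ) (v w : ℤ × ℤ × ℤ) : Prop :=
  l ∣ v.1 * w.2.1 - v.2.1 * w.1 ∧ l ∣ v.1 * w.2.2 - v.2.2 * w.1 ∧
    l ∣ v.2.1 * w.2.2 - v.2.2 * w.2.1

namespace QuatLattice

/-- The pure quaternion `3 * z * i + x * j + y * k`. -/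
def ofVec (v : ℤ × ℤ × ℤ) : QuatLattice := ⟨0, 3 * v.2.2, v.1, v.2.1⟩

/-- The map `v ↦ α * v * star α` on pure quaternions, in coordinates. -/
def rot (α : QuatLattice) (v : ℤ × ℤ × ℤ) : ℤ × ℤ × ℤ :=
  ((α * ofVec v * star α).imJ, (α * ofVec v * star α).imK,
    (α.re ^ 2 + α.imI ^ 2 - 3 * α.imJ ^ 2 - 3 * α.imK ^ 2) * v.2.2
      + 2 * (α.re * α.imJ + α.imI * α.imK) * v.2.1 + 2 * (α.imI * α.imJ - α.re * α.imK) * v.1)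

theorem ofVec_rot (α : QuatLattice) (v : ℤ × ℤ × ℤ) :
    ofVec (rot α v) = α * ofVec v * star α := by
  ext <;> simp [ofVec, rot] <;> ring

theorem ofVec_injective : Function.Injective ofVec := by
  rintro ⟨x, y, z⟩ ⟨x', y', z'⟩ h
  have h1 := congrArg QuaternionAlgebra.imI h
  have h2 := congrArg QuaternionAlgebra.imJ h
  have h3 := congrArg QuaternionAlgebra.imK h
  simp [ofVec] at h1 h2 h3
  simp [h1, h2, h3]

theorem star_ofVec (v : ℤ × ℤ × ℤ) : star (ofVec v) = -ofVec v := by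
  ext <;> simp [ofVec]

theorem ofVec_smul (n : ℤ) (v : ℤ × ℤ × ℤ) : ofVec (n • v) = n • ofVec v := by
  ext <;> simp [ofVec]
  ring

theorem ofVec_mul_add (v w : ℤ × ℤ × ℤ) :
    ofVec v * ofVec w + ofVec w * ofVec v = (-6 * ternaryBilin v w) • 1 := by
  obtain ⟨t, ht⟩ : ∃ t, -6 * ternaryBilin v w = t := ⟨_, rfl⟩
  rw [ht]
  unfold ternaryBilin at ht
  ext <;> simp [ofVec] <;> first | linear_combination ht | ring

theorem ofVec_mul_self (v : ℤ × ℤ × ℤ) : ofVec v * ofVec v = (-3 * ternaryForm v) • 1 := by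
  obtain ⟨t, ht⟩ : ∃ t, -3 * ternaryForm v = t := ⟨_, rfl⟩
  rw [ht]
  unfold ternaryForm at ht
  ext <;> simp [ofVec] <;> first | linear_combination ht | ring

theorem smul_one_injective : Function.Injective fun n : ℤ ↦ n • (1 : QuatLattice) := by
  intro m n h
  simpa using congrArg QuaternionAlgebra.re h

variable {l : ℤ} {α γ : QuatLattice} {v : ℤ × ℤ × ℤ}

theorem rot_star_rot (h : star α * α = l • 1) (w : ℤ × ℤ × ℤ) :
    rot (star α) (rot α w) = l ^ 2 • w := by
  apply ofVec_injective
  rw [ofVec_rot, ofVec_rot, ofVec_smul, star_star]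
  linear_combination (norm := (noncomm_ring; module)) h * ofVec w * (star α * α) + l • ofVec w * h

theorem ternaryForm_rot (h : star α * α = l • 1) (h' : α * star α = l • 1) (w : ℤ × ℤ × ℤ) :
    ternaryForm (rot α w) = l ^ 2 * ternaryForm w := by
  have h1 := ofVec_mul_self (rot α w)
  have h2 := ofVec_mul_self w
  have h3 : (-3 * ternaryForm (rot α w)) • (1 : QuatLattice)
      = (-3 * (l ^ 2 * ternaryForm w)) • 1 := by
    rw [← h1, ofVec_rot]
    linear_combination (norm := (noncomm_ring; module)) α * ofVec w * h * ofVec w * star α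
      + l • (α * h2 * star α) + (l * (-3 * ternaryForm w)) • h'
  have := smul_one_injective h3
  linarith

theorem star_mul_star_eq (hv : α * γ = 2 • ofVec v) : star γ * star α = (-2) • ofVec v := by
  rw [← star_mul, hv, star_smul, star_ofVec]
  simp

theorem ofVec_mul_ofVec_rot (h : star α * α = l • 1) (hv : α * γ = 2 • ofVec v)
    (w : ℤ × ℤ × ℤ) : (-2) • (ofVec v * ofVec (rot α w)) = l • (star γ * ofVec w * star α) := by
  have h1 := star_mul_star_eq hv
  rw [ofVec_rot]
  linear_combination (norm := noncomm_ring)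
    (-1 : QuatLattice) * h1 * (α * ofVec w * star α) + star γ * h * (ofVec w * star α)

theorem smul_star_mul_mul (h : star α * α = l • 1) (hv : α * γ = 2 • ofVec v)
    (y z : ℤ × ℤ × ℤ) :
    (2 * (-6 * ternaryBilin v z)) • (star α * ofVec y * α) =
      (2 * (-6 * ternaryBilin v y)) • (star α * ofVec z * α)
        - l • (γ * ofVec y * ofVec z * α) - l • (star α * ofVec y * ofVec z * star γ) := by
  have h1 := star_mul_star_eq hv
  have hz := ofVec_mul_add v z
  have hy := ofVec_mul_add v y
  linear_combination (norm := (noncomm_ring; module))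
    (-2 : QuatLattice) * star α * ofVec y * hz * α + (2 : QuatLattice) * star α * hy * ofVec z * α
     - h * (γ * ofVec y * ofVec z * α)
     + star α * hv * (ofVec y * ofVec z * α)
     - star α * ofVec y * ofVec z * star γ * h + star α * ofVec y * ofVec z * h1 * α

theorem smul_mul_eq (h : star α * α = l • 1) (hv : α * γ = 2 • ofVec v) {m : ℤ}
    (hm : γ * star γ = m • 1) (y : ℤ × ℤ × ℤ) :
    (2 * (-6 * ternaryBilin v y)) • (γ * α) =
      -m • (star α * ofVec y * α) - l • (γ * ofVec y * star γ) := by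
  have h1 := star_mul_star_eq hv
  have hy := ofVec_mul_add v y
  linear_combination (norm := (noncomm_ring; module))
    (-2 : QuatLattice) * γ * hy * α + γ * h1 * ofVec y * α - hm * (star α * ofVec y * α)
      + γ * ofVec y * h1 * α - γ * ofVec y * star γ * h

theorem smul_ofVec_eq (hv : α * γ = 2 • ofVec v) (y : ℤ × ℤ × ℤ) :
    (4 * (-6 * ternaryBilin v y)) • ofVec v =
      -(star γ * (star α * ofVec y * α) * γ) - (12 * ternaryForm v) • ofVec y := by
  have h1 := star_mul_star_eq hv
  have hy := ofVec_mul_add v y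
  have hq := ofVec_mul_self v
  linear_combination (norm := (noncomm_ring; module))
    (-4 : QuatLattice) * ofVec v * hy + (4 : QuatLattice) * hq * ofVec y
      + h1 * ofVec y * α * γ - (2 : QuatLattice) * ofVec v * ofVec y * hv

theorem exists_normSq (γ : QuatLattice) :
    ∃ m : ℤ, star γ * γ = m • 1 ∧ γ * star γ = m • 1 := by
  obtain ⟨m, hm⟩ : ∃ m, γ.re ^ 2 + γ.imI ^ 2 + 3 * γ.imJ ^ 2 + 3 * γ.imK ^ 2 = m := ⟨_, rfl⟩
  refine ⟨m, ?_, ?_⟩ <;> ext <;> simp <;> first | linear_combination hm | ring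

theorem rot_smul (n : ℤ) (w : ℤ × ℤ × ℤ) : rot α (n • w) = n • rot α w := by
  apply ofVec_injective
  rw [ofVec_rot, ofVec_smul, ofVec_smul, ofVec_rot, mul_smul_comm, smul_mul_assoc]

theorem exists_smul_of_isCoprime {n L : ℤ} (hn : IsCoprime n L) {x q : QuatLattice}
    (h : n • x = L • q) : ∃ q', x = L • q' := by
  obtain ⟨a, b, hab⟩ := hn
  refine ⟨a • q + b • x, ?_⟩
  have : x = (a * n + b * L) • x := by rw [hab, one_smul]
  rw [smul_add, smul_comm L a q, ← h]
  conv_lhs => rw [this]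
  module

theorem dvdVec_iff {L : ℤ} {w : ℤ × ℤ × ℤ} : DvdVec L w ↔ ∃ s, w = L • s := by
  constructor
  · rintro ⟨⟨a, ha⟩, ⟨b, hb⟩, ⟨c, hc⟩⟩
    exact ⟨(a, b, c), by ext <;> simp [*]⟩
  · rintro ⟨s, rfl⟩
    exact ⟨⟨_, rfl⟩, ⟨_, rfl⟩, ⟨_, rfl⟩⟩

theorem exists_eq_smul_of_isCoprime {n L : ℤ} (hn : IsCoprime n L) (h3 : IsCoprime 3 L)
    {w : ℤ × ℤ × ℤ} {q : QuatLattice} (h : n • ofVec w = L • q) : ∃ s, w = L • s := by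
  obtain ⟨q', hq⟩ := exists_smul_of_isCoprime hn h
  have h1 := congrArg QuaternionAlgebra.imI hq
  have h2 := congrArg QuaternionAlgebra.imJ hq
  have h4 := congrArg QuaternionAlgebra.imK hq
  simp [ofVec] at h1 h2 h4
  exact dvdVec_iff.1 ⟨⟨_, h2⟩, ⟨_, h4⟩, h3.symm.dvd_of_dvd_mul_left ⟨_, h1⟩⟩

theorem exists_not_dvd_bilin (h3 : IsCoprime 3 l) (hv : ¬ DvdVec l v) :
    ∃ z, ¬ l ∣ ternaryBilin v z := by
  by_contra! h
  have h1 := h (1, 0, 0)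
  have h2 := h (0, 1, 0)
  have h4 := h (0, 0, 1)
  simp [ternaryBilin] at h1 h2 h4
  exact hv ⟨h1, h2, h3.symm.dvd_of_dvd_mul_left h4⟩

theorem exists_eq_add_of_collinearMod (hl : Prime l) (hv : ¬ DvdVec l v) {w : ℤ × ℤ × ℤ}
    (h : CollinearMod l v w) : ∃ (a : ℤ) (s : ℤ × ℤ × ℤ), w = a • v + l • s := by
  obtain ⟨x, y, z⟩ := v
  obtain ⟨x', y', z'⟩ := w
  obtain ⟨⟨p, hp⟩, ⟨q, hq⟩, ⟨r, hr⟩⟩ := h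
  simp only at hp hq hr
  have key : ∀ t t' : ℤ, ¬ l ∣ t → (∃ s, t • (x', y', z') = t' • (x, y, z) + l • s) →
      ∃ (a : ℤ) (s : ℤ × ℤ × ℤ), (x', y', z') = a • (x, y, z) + l • s := by
    rintro t t' ht ⟨s, hs⟩
    obtain ⟨a, b, hab⟩ := (hl.irreducible.coprime_iff_not_dvd.2 ht).symm
    refine ⟨a * t', a • s + b • (x', y', z'), ?_⟩
    have : (x', y', z') = (a * t + b * l) • (x', y', z') := by rw [hab, one_smul]
    conv_lhs => rw [this]
    linear_combination a • hs
  by_cases hx : l ∣ x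
  · by_cases hy : l ∣ y
    · have hz : ¬ l ∣ z := fun hz ↦ hv ⟨hx, hy, hz⟩
      refine key z z' hz ⟨(-q, -r, 0), ?_⟩
      ext <;> simp <;> linarith
    · refine key y y' hy ⟨(-p, 0, r), ?_⟩
      ext <;> simp <;> linarith
  · refine key x x' hx ⟨(0, p, q), ?_⟩
    ext <;> simp <;> linarith

theorem mem_range_rot_iff_star (h : star α * α = l • 1) (h' : α * star α = l • 1) (hl : l ≠ 0)
    (w : ℤ × ℤ × ℤ) : l • w ∈ Set.range (rot α) ↔ ∃ s, rot (star α) w = l • s := by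
  have h₁ := rot_star_rot h
  have h₂ := rot_star_rot (α := star α) (by rwa [star_star])
  rw [star_star] at h₂
  constructor
  · rintro ⟨s, hs⟩
    refine ⟨s, smul_right_injective _ hl ?_⟩
    simp only
    rw [← rot_smul, ← hs, h₁, pow_two, mul_smul]
  · rintro ⟨s, hs⟩
    refine ⟨s, smul_right_injective _ hl ?_⟩
    simp only
    rw [← rot_smul, ← hs, h₂, pow_two, mul_smul]

theorem mem_range_rot_of_sq (h' : α * star α = l • 1) (hl : l ≠ 0)
    {w : ℤ × ℤ × ℤ} (hw : ∃ s, rot (star α) w = l ^ 2 • s) : w ∈ Set.range (rot α) := by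
  have h₂ := rot_star_rot (α := star α) (by rwa [star_star])
  rw [star_star] at h₂
  obtain ⟨s, hs⟩ := hw
  refine ⟨s, smul_right_injective _ (pow_ne_zero 2 hl) ?_⟩
  simp only
  rw [← rot_smul, ← hs, h₂]

theorem exists_rot_star_eq (hl : Prime l) (h2 : IsCoprime 2 l) (h3 : IsCoprime 3 l)
    (h : star α * α = l • 1) (hv : α * γ = 2 • ofVec v) (hv0 : ¬ DvdVec l v)
    (hQ : l ^ 2 ∣ ternaryForm v) : ∃ s, rot (star α) v = l ^ 2 • s := by
  obtain ⟨m, hm, hm'⟩ := exists_normSq γ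
  obtain ⟨k, hk⟩ := hQ
  have h12 : m = l * (12 * k) := by
    have h1 := star_mul_star_eq hv
    have hq := ofVec_mul_self v
    have : (l * m) • (1 : QuatLattice) = (12 * ternaryForm v) • 1 := by
      linear_combination (norm := (noncomm_ring; module))
        -l • hm - star γ * h * γ + h1 * α * γ - (2 : QuatLattice) * ofVec v * hv
          - (4 : QuatLattice) * hq
    have := smul_one_injective this
    refine mul_left_cancel₀ hl.ne_zero ?_
    rw [this, hk]
    ring
  obtain ⟨z, hz⟩ := exists_not_dvd_bilin h3 hv0
  have key := smul_mul_eq h hv hm' z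
  have hcop : IsCoprime (2 * (-6 * ternaryBilin v z)) l := by
    have := (hl.irreducible.coprime_iff_not_dvd.2 hz).symm
    have := (h2.mul_left (h2.mul_left h3)).mul_left this
    rw [show 2 * (-6 * ternaryBilin v z) = -(2 * (2 * 3) * ternaryBilin v z) by ring]
    exact this.neg_left
  obtain ⟨q, hq⟩ := exists_smul_of_isCoprime hcop (x := γ * α) (L := l)
    (q := -(12 * k) • (star α * ofVec z * α) - γ * ofVec z * star γ) (by
      rw [key, h12]
      module)
  refine exists_eq_smul_of_isCoprime (n := 2) (q := q) h2.pow_right h3.pow_right ?_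
  rw [ofVec_rot, star_star]
  linear_combination (norm := (noncomm_ring; module))
    h * γ * α - star α * hv * α + l • hq

/-- A vector isotropic modulo a prime `l ≥ 5` determines a similitude of ratio `l ^ 2` of the
ternary form, whose image is described in terms of the isotropic line modulo `l`. -/
theorem exists_similitude {l : ℕ} (hl : l.Prime) (hl2 : l ≠ 2) (hl3 : l ≠ 3) {v : ℤ × ℤ × ℤ}
    (hv : (l : ℤ) ∣ ternaryForm v) (hv0 : ¬ DvdVec l v) :
    ∃ M : ℤ × ℤ × ℤ → ℤ × ℤ × ℤ, Function.Injective M ∧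
      (∀ w, ternaryForm (M w) = (l : ℤ) ^ 2 * ternaryForm w) ∧
      (∀ w, (l : ℤ) ^ 2 ∣ ternaryForm w → ¬ DvdVec l w →
        (w ∈ Set.range M ↔ CollinearMod l v w)) ∧
      ∀ w, (l : ℤ) • w ∈ Set.range M ↔ (l : ℤ) ∣ ternaryBilin v w := by
  have hp := Nat.prime_iff_prime_int.1 hl
  have h2 : IsCoprime (2 : ℤ) l :=
    Nat.isCoprime_iff_coprime.2 ((Nat.coprime_primes Nat.prime_two hl).2 hl2.symm)
  have h3 : IsCoprime (3 : ℤ) l :=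
    Nat.isCoprime_iff_coprime.2 ((Nat.coprime_primes Nat.prime_three hl).2 hl3.symm)
  obtain ⟨a, b, c, d, e, f, g, i, hn, e1, e2, e4, e5⟩ := exists_quaternion_factor hl hl2 hl3 hv hv0
  obtain ⟨α, hα⟩ : ∃ α : QuatLattice, α = ⟨a, b, c, d⟩ := ⟨_, rfl⟩
  obtain ⟨γ, hγ⟩ : ∃ γ : QuatLattice, γ = ⟨e, f, g, i⟩ := ⟨_, rfl⟩
  have h : star α * α = (l : ℤ) • 1 := by
    obtain ⟨n, hn'⟩ : ∃ n : ℤ, n = l := ⟨_, rfl⟩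
    rw [← hn'] at hn ⊢
    rw [hα]
    ext <;> simp <;> first | linear_combination hn | ring
  have h' : α * star α = (l : ℤ) • 1 := by
    obtain ⟨n, hn'⟩ : ∃ n : ℤ, n = l := ⟨_, rfl⟩
    rw [← hn'] at hn ⊢
    rw [hα]
    ext <;> simp <;> first | linear_combination hn | ring
  have hαγ : α * γ = 2 • ofVec v := by
    rw [hα, hγ]
    ext <;> simp [ofVec]
    · linear_combination e1
    · linear_combination e2
    · linear_combination e4
    · linear_combination e5
  refine ⟨rot α, fun w w' hw ↦ ?_, ternaryForm_rot h h', fun w hQ hw ↦ ?_, fun w ↦ ?_⟩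
  · have := congrArg (rot (star α)) hw
    rw [rot_star_rot h, rot_star_rot h] at this
    exact smul_right_injective _ (pow_ne_zero 2 hp.ne_zero) this
  · constructor
    · rintro ⟨s, rfl⟩
      have key := ofVec_mul_ofVec_rot h hαγ s
      obtain ⟨q, hq⟩ := exists_smul_of_isCoprime h2.neg_left key
      have k1 := congrArg QuaternionAlgebra.imI hq
      have k2 := congrArg QuaternionAlgebra.imJ hq
      have k3 := congrArg QuaternionAlgebra.imK hq
      generalize rot α s = w at *
      simp [ofVec] at k1 k2 k3
      refine ⟨h3.symm.dvd_of_dvd_mul_left ⟨q.imI, ?_⟩, h3.symm.dvd_of_dvd_mul_left ⟨-q.imK, ?_⟩,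
        h3.symm.dvd_of_dvd_mul_left ⟨q.imJ, ?_⟩⟩
      · linear_combination k1
      · linear_combination -k3
      · linear_combination k2
    · intro hcol
      obtain ⟨r, s, hs⟩ := exists_eq_add_of_collinearMod hp hv0 hcol
      refine mem_range_rot_of_sq h' hp.ne_zero
        (exists_rot_star_eq (γ := r • γ + 2 • (star α * ofVec s)) hp h2 h3 h ?_ hw hQ)
      have hw' : ofVec w = r • ofVec v + (l : ℤ) • ofVec s := by
        rw [hs]
        ext <;> simp [ofVec]
        ring
      rw [hw']
      linear_combination (norm := (noncomm_ring; module)) r • hαγ + 2 • (h' * ofVec s)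
  · rw [mem_range_rot_iff_star h h' hp.ne_zero]
    constructor
    · rintro ⟨s, hs⟩
      have key := smul_ofVec_eq hαγ w
      have hs' := ofVec_rot (star α) w
      rw [star_star] at hs'
      obtain ⟨k, hk⟩ := hv
      rw [hk, ← hs', hs, ofVec_smul] at key
      by_contra hdvd
      have hcop : IsCoprime (4 * (-6 * ternaryBilin v w)) (l : ℤ) := by
        have := (hp.irreducible.coprime_iff_not_dvd.2 hdvd).symm
        have := (h2.mul_left (h2.mul_left (h2.mul_left h3))).mul_left this
        rw [show 4 * (-6 * ternaryBilin v w) = -(2 * (2 * (2 * 3)) * ternaryBilin v w) by ring]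
        exact this.neg_left
      refine hv0 (dvdVec_iff.2 (exists_eq_smul_of_isCoprime hcop h3
        (q := -(star γ * ofVec s * γ) - (12 * k) • ofVec w) ?_))
      rw [key]
      simp only [mul_smul_comm, smul_mul_assoc]
      module
    · intro hdvd
      obtain ⟨z, hz⟩ := exists_not_dvd_bilin h3 hv0
      have key := smul_star_mul_mul h hαγ w z
      have hcop : IsCoprime (2 * (-6 * ternaryBilin v z)) (l : ℤ) := by
        have := (hp.irreducible.coprime_iff_not_dvd.2 hz).symm
        have := (h2.mul_left (h2.mul_left h3)).mul_left this
        rw [show 2 * (-6 * ternaryBilin v z) = -(2 * (2 * 3) * ternaryBilin v z) by ring]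
        exact this.neg_left
      have hs' := ofVec_rot (star α) w
      rw [star_star] at hs'
      obtain ⟨k, hk⟩ := hdvd
      rw [hk, ← hs'] at key
      refine exists_eq_smul_of_isCoprime hcop h3 (q := (2 * (-6 * k)) • (star α * ofVec z * α)
        - γ * ofVec w * ofVec z * α - star α * ofVec w * ofVec z * star γ) ?_
      rw [key]
      module

end QuatLattice

end Rotation

section Conic

variable {l : ℕ} [Fact l.Prime]

theorem card_projective_zeros (hl2 : l ≠ 2) {a b c : ZMod l} (h : ¬ (a = 0 ∧ b = 0 ∧ c = 0)) :
    ((Finset.univ.filter fun u : Option (ZMod l) ↦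
      u.elim a (fun p ↦ a * p ^ 2 + 2 * b * p + c) = 0).card : ℤ)
      = 1 + quadraticChar (ZMod l) (b ^ 2 - a * c) := by
  have hc : ringChar (ZMod l) ≠ 2 := by rwa [ZMod.ringChar_zmod_n]
  have h2 : (2 : ZMod l) ≠ 0 := Ring.two_ne_zero hc
  have hsplit : ((Finset.univ.filter fun u : Option (ZMod l) ↦
      u.elim a (fun p ↦ a * p ^ 2 + 2 * b * p + c) = 0).card : ℤ) = (if a = 0 then 1 else 0) +
      ((Finset.univ.filter fun p : ZMod l ↦ a * p ^ 2 + 2 * b * p + c = 0).card : ℤ) := by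
    rw [Finset.card_filter, Fintype.sum_option, Finset.card_filter]
    push_cast
    rfl
  rw [hsplit]
  by_cases ha : a = 0
  · subst ha
    by_cases hb : b = 0
    · subst hb
      have : c ≠ 0 := by tauto
      simp [this]
    · have : (Finset.univ.filter fun p : ZMod l ↦ 0 * p ^ 2 + 2 * b * p + c = 0)
          = {-c / (2 * b)} := by
        ext p
        simp only [Finset.mem_filter, Finset.mem_univ, true_and, Finset.mem_singleton]
        rw [eq_div_iff (mul_ne_zero h2 hb)]
        constructor <;> intro h <;> linear_combination h
      rw [this]
      simp [quadraticChar_sq_one' hb]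
  · rw [if_neg ha, zero_add, add_comm, ← quadraticChar_card_sqrts hc]
    norm_cast
    refine Finset.card_bij (fun p _ ↦ a * p + b) ?_ ?_ ?_
    · intro p hp
      simp only [Finset.mem_filter, Finset.mem_univ, true_and] at hp
      simp only [Set.mem_toFinset, Set.mem_ofPred_eq]
      linear_combination a * hp
    · intro p _ q _ h
      exact mul_left_cancel₀ ha (add_right_cancel h)
    · intro y hy
      simp only [Set.mem_toFinset, Set.mem_ofPred_eq] at hy
      refine ⟨(y - b) / a, ?_, by field_simp; ring⟩
      simp only [Finset.mem_filter, Finset.mem_univ, true_and]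
      have : a * (a * ((y - b) / a) ^ 2 + 2 * b * ((y - b) / a) + c) = 0 := by
        field_simp
        linear_combination hy
      exact (mul_eq_zero.1 this).resolve_left ha

theorem cross_eq_zero {F : Type*} [Field F] {x y z x' y' z' : F} (h3 : (3 : F) ≠ 0)
    (h1 : x ^ 2 + y ^ 2 + 3 * z ^ 2 = 0) (h2 : x' ^ 2 + y' ^ 2 + 3 * z' ^ 2 = 0)
    (h : x * x' + y * y' + 3 * (z * z') = 0) :
    x * y' - y * x' = 0 ∧ x * z' - z * x' = 0 ∧ y * z' - z * y' = 0 := by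
  obtain ⟨A, hA⟩ : ∃ A, x * y' - y * x' = A := ⟨_, rfl⟩
  obtain ⟨B, hB⟩ : ∃ B, x * z' - z * x' = B := ⟨_, rfl⟩
  obtain ⟨C, hC⟩ : ∃ C, y * z' - z * y' = C := ⟨_, rfl⟩
  have e1 : x * B + y * C = 0 := by rw [← hB, ← hC]; linear_combination z' * h1 - z * h
  have e2 : x' * B + y' * C = 0 := by rw [← hB, ← hC]; linear_combination -z * h2 + z' * h
  have e3 : x * A = 3 * z * C := by rw [← hA, ← hC]; linear_combination y' * h1 - y * h
  have e4 : x' * A = 3 * z' * C := by rw [← hA, ← hC]; linear_combination y' * h - y * h2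
  have e5 : y * A = -(3 * z * B) := by rw [← hA, ← hB]; linear_combination x * h - x' * h1
  have e6 : y' * A = -(3 * z' * B) := by rw [← hA, ← hB]; linear_combination x * h2 - x' * h
  rw [hA, hB, hC]
  have hA0 : A = 0 := by
    refine pow_eq_zero_iff (n := 3) (by norm_num) |>.1 ?_
    calc A ^ 3 = (x * A) * (y' * A) - (y * A) * (x' * A) := by rw [← hA]; ring
      _ = 0 := by rw [e3, e4, e5, e6]; ring
  subst hA0
  have zC : z * C = 0 := by
    refine (mul_eq_zero.1 (?_ : 3 * (z * C) = 0)).resolve_left h3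
    linear_combination -e3
  have zC' : z' * C = 0 := by
    refine (mul_eq_zero.1 (?_ : 3 * (z' * C) = 0)).resolve_left h3
    linear_combination -e4
  have zB : z * B = 0 := by
    refine (mul_eq_zero.1 (?_ : 3 * (z * B) = 0)).resolve_left h3
    linear_combination e5
  have zB' : z' * B = 0 := by
    refine (mul_eq_zero.1 (?_ : 3 * (z' * B) = 0)).resolve_left h3
    linear_combination e6
  refine ⟨rfl, ?_, ?_⟩
  · refine pow_eq_zero_iff (n := 2) (by norm_num) |>.1 ?_
    linear_combination B * (-hB) + x * zB' - x' * zB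
  · refine pow_eq_zero_iff (n := 2) (by norm_num) |>.1 ?_
    linear_combination C * (-hC) + y * zC' - y' * zC

theorem exists_isotropic_family (hl2 : l ≠ 2) (hl3 : l ≠ 3) :
    ∃ v : Option (ZMod l) → ℤ × ℤ × ℤ,
      (∀ u, (l : ℤ) ∣ ternaryForm (v u) ∧ ¬ DvdVec l (v u)) ∧
      (∀ w, ¬ DvdVec l w →
        ((Finset.univ.filter fun u ↦ (l : ℤ) ∣ ternaryBilin (v u) w).card : ℤ)
          = 1 + legendreSym l (-3 * ternaryForm w)) ∧
      ∀ u w, (l : ℤ) ∣ ternaryForm w → ¬ DvdVec l w →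
        (CollinearMod l (v u) w ↔ (l : ℤ) ∣ ternaryBilin (v u) w) := by
  have hl : l.Prime := Fact.out
  have h2 : (2 : ZMod l) ≠ 0 := by
    intro h
    exact hl2 ((Nat.prime_dvd_prime_iff_eq hl Nat.prime_two).1 ((ZMod.natCast_eq_zero_iff 2 l).1
      (by exact_mod_cast h)))
  have h3 : (3 : ZMod l) ≠ 0 := by
    intro h
    exact hl3 ((Nat.prime_dvd_prime_iff_eq hl Nat.prime_three).1 ((ZMod.natCast_eq_zero_iff 3 l).1
      (by exact_mod_cast h)))
  have hdvd : ∀ n : ℤ, (l : ℤ) ∣ n ↔ (n : ZMod l) = 0 := fun n ↦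
    (ZMod.intCast_zmod_eq_zero_iff_dvd n l).symm
  obtain ⟨a, b, hab⟩ := ZMod.sq_add_sq l (-3)
  let V : Option (ZMod l) → ZMod l × ZMod l × ZMod l := fun u ↦
    u.elim (a, b, 1) fun p ↦
      (a * (p ^ 2 - 1) - 2 * b * p, b * (p ^ 2 - 1) + 2 * a * p, p ^ 2 + 1)
  let v : Option (ZMod l) → ℤ × ℤ × ℤ := fun u ↦
    ((V u).1.cast, (V u).2.1.cast, (V u).2.2.cast)
  have c1 : ∀ u, ((v u).1 : ZMod l) = (V u).1 := fun u ↦ ZMod.intCast_zmod_cast _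
  have c2 : ∀ u, ((v u).2.1 : ZMod l) = (V u).2.1 := fun u ↦ ZMod.intCast_zmod_cast _
  have c3 : ∀ u, ((v u).2.2 : ZMod l) = (V u).2.2 := fun u ↦ ZMod.intCast_zmod_cast _
  clear_value v
  have hQ : ∀ u, (l : ℤ) ∣ ternaryForm (v u) := by
    intro u
    rw [hdvd, ternaryForm]
    push_cast
    rw [c1, c2, c3]
    rcases u with _ | p
    · simp only [V, Option.elim]
      linear_combination hab
    · simp only [V, Option.elim]
      linear_combination ((p ^ 2 - 1) ^ 2 + 4 * p ^ 2) * hab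
  have h0 : ∀ u, ¬ DvdVec l (v u) := by
    intro u
    simp only [DvdVec, hdvd, c1, c2, c3]
    rcases u with _ | p
    · simp [V]
    · simp only [V, Option.elim]
      rintro ⟨k1, k2, k3⟩
      have : 3 * (p ^ 2 - 1) = 0 := by
        linear_combination -a * k1 - b * k2 + (p ^ 2 - 1) * hab
      have := (mul_eq_zero.1 this).resolve_left h3
      exact h2 (by linear_combination k3 - this)
  refine ⟨v, fun u ↦ ⟨hQ u, h0 u⟩, fun w hw ↦ ?_, fun u w hw hw0 ↦ ⟨?_, fun hB ↦ ?_⟩⟩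
  · obtain ⟨x, y, z⟩ := w
    have key := card_projective_zeros hl2 (a := (x * a + y * b + 3 * z : ZMod l))
      (b := (y * a - x * b : ZMod l)) (c := (-(x * a) - y * b + 3 * z : ZMod l)) (by
        rintro ⟨k1, k2, k3⟩
        refine hw ?_
        simp only [DvdVec, hdvd]
        have hz : (z : ZMod l) = 0 := by
          have : 2 * (3 * (z : ZMod l)) = 0 := by linear_combination k1 + k3
          exact (mul_eq_zero.1 ((mul_eq_zero.1 this).resolve_left h2)).resolve_left h3
        have k4 : (x * a + y * b : ZMod l) = 0 := by linear_combination k1 - 3 * hz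
        refine ⟨(mul_eq_zero.1 (?_ : 3 * (x : ZMod l) = 0)).resolve_left h3,
          (mul_eq_zero.1 (?_ : 3 * (y : ZMod l) = 0)).resolve_left h3, hz⟩
        · linear_combination x * hab - a * k4 + b * k2
        · linear_combination y * hab - b * k4 - a * k2)
    rw [legendreSym]
    convert key using 3
    · congr 1
      ext u
      simp only [hdvd, ternaryBilin]
      push_cast
      rw [c1, c2, c3]
      rcases u with _ | p
      · simp only [V, Option.elim]
        constructor <;> intro h <;> linear_combination h
      · simp only [V, Option.elim]
        constructor <;> intro h <;> linear_combination h
    · simp only [ternaryForm]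
      push_cast
      linear_combination (-(x : ZMod l) ^ 2 - (y : ZMod l) ^ 2) * hab
  · intro hcol
    obtain ⟨r, s, rfl⟩ := QuatLattice.exists_eq_add_of_collinearMod
      (Nat.prime_iff_prime_int.1 hl) (h0 u) hcol
    obtain ⟨k, hk⟩ := hQ u
    refine ⟨r * k + ternaryBilin (v u) s, ?_⟩
    unfold ternaryForm at hk
    simp [ternaryBilin]
    linear_combination r * hk
  · have e1 := (hdvd _).1 (hQ u)
    have e2 := (hdvd _).1 hw
    rw [hdvd] at hB
    simp only [ternaryForm, ternaryBilin] at e1 e2 hB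
    push_cast at e1 e2 hB
    simp only [CollinearMod, hdvd]
    push_cast
    exact cross_eq_zero h3 e1 e2 hB

end Conic

section Count

open Finset

theorem mem_ternaryReps_iff {v : ℤ × ℤ × ℤ} {n : ℕ} : v ∈ ternaryReps n ↔ ternaryForm v = n :=
  mem_ternaryReps

theorem ternaryForm_smul (m : ℤ) (v : ℤ × ℤ × ℤ) :
    ternaryForm (m • v) = m ^ 2 * ternaryForm v := by
  simp [ternaryForm]
  ring

open Classical in
theorem card_filter_dvdVec {m : ℕ} (hm : m ≠ 0) (n : ℕ) :
    ((ternaryReps (m ^ 2 * n)).filter (DvdVec m)).card = (ternaryReps n).card := by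
  have hm' : (m : ℤ) ≠ 0 := by exact_mod_cast hm
  symm
  refine card_bij (fun v _ ↦ (m : ℤ) • v) ?_ ?_ ?_
  · intro v hv
    rw [mem_filter, mem_ternaryReps_iff, ternaryForm_smul, mem_ternaryReps_iff.1 hv]
    exact ⟨by push_cast; rfl, QuatLattice.dvdVec_iff.2 ⟨v, rfl⟩⟩
  · intro v _ w _ h
    exact smul_right_injective _ hm' h
  · intro v hv
    rw [mem_filter, mem_ternaryReps_iff] at hv
    obtain ⟨w, rfl⟩ := QuatLattice.dvdVec_iff.1 hv.2
    refine ⟨w, mem_ternaryReps_iff.2 ?_, rfl⟩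
    have := hv.1
    rw [ternaryForm_smul] at this
    push_cast at this
    exact mul_left_cancel₀ (pow_ne_zero 2 hm') this

theorem sq_dvd_of_dvdVec {m : ℤ} {v : ℤ × ℤ × ℤ} (h : DvdVec m v) : m ^ 2 ∣ ternaryForm v := by
  obtain ⟨w, rfl⟩ := QuatLattice.dvdVec_iff.1 h
  exact ⟨_, ternaryForm_smul m w⟩

theorem dvdVec_sq_smul {m : ℤ} (hm : m ≠ 0) (v : ℤ × ℤ × ℤ) :
    DvdVec (m ^ 2) (m • v) ↔ DvdVec m v := by
  simp [DvdVec, pow_two, mul_dvd_mul_iff_left hm]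

open Classical in
/-- The Hecke relation of level `l ^ 2` for the number of representations by
`x ^ 2 + y ^ 2 + 3 * z ^ 2`. -/
theorem card_ternaryReps_sq_mul {l : ℕ} [Fact l.Prime] (hl2 : l ≠ 2) (hl3 : l ≠ 3) (n : ℕ) :
    ((ternaryReps (l ^ 2 * n)).card : ℤ) =
      (l + 1 - legendreSym l (-3 * n)) * (ternaryReps n).card
        - l * (if l ^ 2 ∣ n then ((ternaryReps (n / l ^ 2)).card : ℤ) else 0) := by
  have hl : l.Prime := Fact.out
  have hl0 : (l : ℤ) ≠ 0 := by exact_mod_cast hl.ne_zero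
  obtain ⟨v, hv, hcount, hcol⟩ := exists_isotropic_family hl2 hl3
  choose M hinj hform hprim hsmul using fun u ↦
    QuatLattice.exists_similitude hl hl2 hl3 (hv u).1 (hv u).2
  have hrow : ∀ u, ((ternaryReps (l ^ 2 * n)).filter fun x ↦ x ∈ Set.range (M u)).card
      = (ternaryReps n).card := by
    intro u
    rw [← card_image_of_injective (ternaryReps n) (hinj u)]
    congr 1
    ext x
    rw [mem_filter, mem_image, mem_ternaryReps_iff]
    constructor
    · rintro ⟨hx, y, rfl⟩
      refine ⟨y, mem_ternaryReps_iff.2 ?_, rfl⟩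
      rw [hform] at hx
      push_cast at hx
      exact mul_left_cancel₀ (pow_ne_zero 2 hl0) hx
    · rintro ⟨y, hy, rfl⟩
      rw [hform, mem_ternaryReps_iff.1 hy]
      exact ⟨by push_cast; rfl, y, rfl⟩
  have hcolumn : ∀ x ∈ ternaryReps (l ^ 2 * n),
      ((univ.filter fun u ↦ x ∈ Set.range (M u)).card : ℤ) =
        1 + legendreSym l (-3 * n) * (if DvdVec l x then 1 else 0)
          + l * (if DvdVec ((l ^ 2 : ℕ) : ℤ) x then 1 else 0) := by
    intro x hx
    rw [mem_ternaryReps_iff] at hx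
    have hxl : (l : ℤ) ^ 2 ∣ ternaryForm x := ⟨n, by rw [hx]; push_cast; rfl⟩
    push_cast
    by_cases hdx : DvdVec l x
    · obtain ⟨y, rfl⟩ := QuatLattice.dvdVec_iff.1 hdx
      have hy : ternaryForm y = n := by
        rw [ternaryForm_smul] at hx
        push_cast at hx
        exact mul_left_cancel₀ (pow_ne_zero 2 hl0) hx
      simp only [hsmul]
      rw [if_pos hdx, dvdVec_sq_smul hl0]
      by_cases hdy : DvdVec l y
      · have h1 : legendreSym l (-3 * n) = 0 := by
          rw [legendreSym.eq_zero_iff, ZMod.intCast_zmod_eq_zero_iff_dvd, ← hy]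
          exact ((dvd_pow_self _ two_ne_zero).trans (sq_dvd_of_dvdVec hdy)).mul_left _
        rw [if_pos hdy, h1, filter_true_of_mem]
        · simp [ZMod.card, add_comm]
        · intro u _
          exact dvd_add (dvd_add (hdy.1.mul_left _) (hdy.2.1.mul_left _))
            ((hdy.2.2.mul_left _).mul_left _)
      · rw [if_neg hdy, ← hy, mul_one, mul_zero, add_zero]
        exact hcount y hdy
    · have hxl' := (dvd_pow_self (l : ℤ) two_ne_zero).trans hxl
      have hd2 : ¬ DvdVec ((l : ℤ) ^ 2) x := fun h ↦
        hdx ⟨(dvd_pow_self _ two_ne_zero).trans h.1, (dvd_pow_self _ two_ne_zero).trans h.2.1,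
          (dvd_pow_self _ two_ne_zero).trans h.2.2⟩
      have h1 : legendreSym l (-3 * ternaryForm x) = 0 := by
        rw [legendreSym.eq_zero_iff, ZMod.intCast_zmod_eq_zero_iff_dvd]
        exact hxl'.mul_left _
      have h2 := hcount x hdx
      rw [h1] at h2
      rw [if_neg hdx, if_neg hd2, mul_zero, mul_zero, add_zero, ← h2]
      simp only [hprim _ _ hxl hdx, hcol _ _ hxl' hdx]
  have hdouble : ((l : ℤ) + 1) * (ternaryReps n).card =
      ∑ x ∈ ternaryReps (l ^ 2 * n), ((univ.filter fun u ↦ x ∈ Set.range (M u)).card : ℤ) := by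
    have := sum_card_bipartiteAbove_eq_sum_card_bipartiteBelow
      (s := (univ : Finset (Option (ZMod l)))) (t := ternaryReps (l ^ 2 * n))
      fun u x ↦ x ∈ Set.range (M u)
    simp only [bipartiteAbove, bipartiteBelow] at this
    rw [sum_congr rfl fun u _ ↦ hrow u, sum_const, card_univ, Fintype.card_option, ZMod.card,
      smul_eq_mul] at this
    exact_mod_cast this
  rw [sum_congr rfl hcolumn, sum_add_distrib, sum_add_distrib, ← mul_sum, ← mul_sum, sum_boole,
    sum_boole, card_filter_dvdVec hl.ne_zero, sum_const, nsmul_one] at hdouble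
  have hlast : (((ternaryReps (l ^ 2 * n)).filter (DvdVec ((l ^ 2 : ℕ) : ℤ))).card : ℤ) =
      if l ^ 2 ∣ n then ((ternaryReps (n / l ^ 2)).card : ℤ) else 0 := by
    split_ifs with h
    · obtain ⟨k, rfl⟩ := h
      rw [Nat.mul_div_cancel_left _ (pow_pos hl.pos 2), ← mul_assoc, ← pow_two,
        card_filter_dvdVec (pow_ne_zero 2 hl.ne_zero)]
    · rw [Nat.cast_eq_zero, card_eq_zero, filter_eq_empty_iff]
      intro x hx hdx
      refine h ?_
      have := sq_dvd_of_dvdVec hdx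
      rw [mem_ternaryReps_iff.1 hx] at this
      have : (l ^ 2) ^ 2 ∣ l ^ 2 * n := by exact_mod_cast this
      rw [pow_two (l ^ 2)] at this
      exact Nat.dvd_of_mul_dvd_mul_left (pow_pos hl.pos 2) this
  rw [hlast] at hdouble
  linear_combination -hdouble

end Count

section Hecke

theorem legendreSym_neg_three {l : ℕ} [Fact l.Prime] (hl2 : l ≠ 2) (hl3 : l ≠ 3) :
    ((legendreSym l (-3) : ℤ) : ZMod 3) = l := by
  have hl : l.Prime := Fact.out
  have : Fact (Nat.Prime 3) := ⟨Nat.prime_three⟩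
  have h3 : (((3 : ℕ) : ℤ) : ZMod l) ≠ 0 := by
    rw [Int.cast_natCast, Ne, ZMod.natCast_eq_zero_iff,
      Nat.prime_dvd_prime_iff_eq hl Nat.prime_three]
    exact hl3
  have key : legendreSym l (-3) = legendreSym 3 l := by
    rw [show (-3 : ℤ) = -1 * ((3 : ℕ) : ℤ) by norm_num, legendreSym.mul,
      legendreSym.at_neg_one hl2,
      legendreSym.quadratic_reciprocity' (p := 3) (q := l) (by norm_num) hl2,
      ZMod.χ₄_eq_neg_one_pow (hl.eq_two_or_odd.resolve_left hl2), ← mul_assoc, ← pow_add]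
    rw [show l / 2 + 3 / 2 * (l / 2) = 2 * (l / 2) by norm_num; ring]
    simp
  rw [key]
  simpa using legendreSym.eq_pow 3 (l : ℤ)

theorem card_ternaryReps_nine_mul (n : ℕ) :
    (ternaryReps (9 * n)).card = (ternaryReps n).card := by
  classical
  rw [← card_filter_dvdVec three_ne_zero n, show 9 * n = 3 ^ 2 * n by ring]
  congr 1
  ext v
  rw [Finset.mem_filter, iff_self_and]
  intro hv
  rw [mem_ternaryReps] at hv
  push_cast at hv
  obtain ⟨h1, h2⟩ := dvd_of_three_dvd_sq_add_sq (x := v.1) (y := v.2.1)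
    ⟨3 * n - v.2.2 ^ 2, by linarith⟩
  refine ⟨h1, h2, Int.prime_three.dvd_of_dvd_pow (n := 2) ?_⟩
  obtain ⟨a, ha⟩ := h1
  obtain ⟨b, hb⟩ := h2
  rw [ha, hb] at hv
  exact ⟨n - a ^ 2 - b ^ 2, by linarith⟩

end Hecke

theorem pbar_hecke (ℓ : ℕ) (hl : ℓ.Prime) (hodd : ℓ ≠ 2) (n : ℕ) :
    (pbar (3 * ℓ ^ 2 * n) : ℤ) ≡
      ((ℓ : ℤ) - (ℓ : ℤ) * @legendreSym ℓ ⟨hl⟩ (n : ℤ) + 1) * pbar (3 * n)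
        - (ℓ : ℤ) * (if ℓ ^ 2 ∣ 3 * n then (pbar (3 * n / ℓ ^ 2) : ℤ) else 0)
      [ZMOD 3] := by
  have : Fact ℓ.Prime := ⟨hl⟩
  refine (ZMod.intCast_eq_intCast_iff _ _ 3).1 ?_
  have hsign : ∀ k, (-1 : ZMod 3) ^ (ℓ ^ 2 * k) = (-1) ^ k := by
    intro k
    rw [pow_mul, ((hl.odd_of_ne_two hodd).pow).neg_one_pow]
  rw [mul_assoc]
  push_cast
  rw [pbar_three_mul, pbar_three_mul, hsign]
  by_cases h3 : ℓ = 3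
  · subst h3
    have h0 : ((3 : ℕ) : ZMod 3) = 0 := ZMod.natCast_self 3
    rw [h0, show 3 ^ 2 * n = 9 * n by norm_num, card_ternaryReps_nine_mul]
    ring
  · have key := congrArg (Int.cast : ℤ → ZMod 3) (card_ternaryReps_sq_mul hodd h3 n)
    rw [legendreSym.mul] at key
    push_cast at key
    rw [legendreSym_neg_three hodd h3] at key
    have hcop : Nat.Coprime (ℓ ^ 2) 3 :=
      ((Nat.coprime_primes hl Nat.prime_three).2 h3).pow_left 2
    rw [key]
    by_cases hdvd : ℓ ^ 2 ∣ n
    · rw [if_pos hdvd, if_pos (hdvd.mul_left 3), Nat.mul_div_assoc _ hdvd, pbar_three_mul]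
      obtain ⟨k, rfl⟩ := hdvd
      rw [Nat.mul_div_cancel_left _ (pow_pos hl.pos 2), hsign]
      ring
    · rw [if_neg hdvd, if_neg fun h ↦ hdvd (hcop.dvd_of_dvd_mul_left h)]
      ring
end

section
/- For all integers n ≥ 0, (-1)^{n+1} · pod(3n+2) ≡ p̄(24n+15) (mod 3). -/
/-- `pod n`: number of partitions of `n` in which odd parts are not repeated. -/
noncomputable def pod (n : ℕ) : ℕ :=
  Nat.card {p : n.Partition // ∀ i, Odd i → p.parts.count i ≤ 1}

section PodPbar

open Finset PowerSeries

section FiniteIdentities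

variable {A : Type*} [CommRing A]

/-- Finite form of Gauss's identity for `∑ (-1) ^ k * q ^ (k ^ 2)`. -/
theorem sum_neg_one_pow_mul_pow_sq_mul_prod (q : A) (G : ℕ → A)
    (hG : ∀ i, G i * (1 - q ^ (i + 1)) = 1) (n : ℕ) :
    (1 + 2 * ∑ k ∈ range n, (-1) ^ (k + 1) * q ^ ((k + 1) ^ 2)) *
        ∏ i ∈ range n, (1 + q ^ (i + 1)) * G i =
      ∑ s ∈ range (n + 1), (-1) ^ s * (∏ i ∈ range s, (1 + q ^ i) * G i) * q ^ (s * (n + 1)) := by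
  set R : ℕ → A := fun n => ∏ i ∈ range n, (1 + q ^ (i + 1)) * G i with hR
  set T : ℕ → A := fun n => ∏ i ∈ range n, (1 + q ^ i) * G i with hT
  have hT1 (s : ℕ) : T (s + 1) * (1 - q ^ (s + 1)) = T s * (1 + q ^ s) := by
    simp only [hT, prod_range_succ]
    linear_combination (∏ i ∈ range s, (1 + q ^ i) * G i) * (1 + q ^ s) * hG s
  have hR1 (s : ℕ) : R (s + 1) = R s * ((1 + q ^ (s + 1)) * G s) := by
    simp only [hR, prod_range_succ]
  have hTR (s : ℕ) : T s * (1 + q ^ s) = 2 * R s := by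
    induction s with
    | zero => simp [hT, hR]; norm_num
    | succ s ih =>
      rw [hR1]
      have : T (s + 1) = T s * ((1 + q ^ s) * G s) := by simp only [hT, prod_range_succ]
      rw [this]
      linear_combination (1 + q ^ (s + 1)) * G s * ih
  have telescope (x : A) (n : ℕ) :
      (1 - x) * ∑ s ∈ range n, (-1) ^ s * T s * (x ^ s * q ^ s) =
        (1 + x) * ∑ s ∈ range n, (-1) ^ s * T s * x ^ s +
          (-1) ^ n * x ^ n * (T n * (1 - q ^ n)) := by
    induction n with
    | zero => simp
    | succ n ih =>
      rw [sum_range_succ, sum_range_succ, mul_add, mul_add, ih]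
      linear_combination (-(-1) ^ (n + 1) * x ^ (n + 1)) * hT1 n
  change _ * R n = ∑ s ∈ range (n + 1), (-1) ^ s * T s * q ^ (s * (n + 1))
  induction n with
  | zero => simp [hR, hT]
  | succ n ih =>
    have hu : IsUnit (1 - q ^ (n + 1)) := IsUnit.of_mul_eq_one_right _ (hG n)
    apply hu.mul_left_cancel
    have e1 : ∑ s ∈ range (n + 1 + 1), (-1) ^ s * T s * q ^ (s * (n + 1 + 1)) =
        ∑ s ∈ range (n + 1 + 1), (-1) ^ s * T s * ((q ^ (n + 1)) ^ s * q ^ s) := by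
      refine sum_congr rfl fun s _ => ?_
      ring
    have e2 : ∑ s ∈ range (n + 1), (-1) ^ s * T s * q ^ (s * (n + 1)) =
        ∑ s ∈ range (n + 1), (-1) ^ s * T s * (q ^ (n + 1)) ^ s := by
      refine sum_congr rfl fun s _ => ?_
      ring
    rw [e1, sum_range_succ _ (n + 1), mul_add, telescope, ← e2, ← ih, sum_range_succ, hR1]
    have h2 := hTR (n + 1)
    rw [hR1] at h2
    have e3 : (q ^ (n + 1)) ^ (n + 1) = q ^ ((n + 1) ^ 2) := by ring
    rw [e3]
    linear_combination (1 + 2 * ∑ k ∈ range n, (-1) ^ (k + 1) * q ^ ((k + 1) ^ 2)) * R n *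
      (1 + q ^ (n + 1)) * hG n -
      (-1) ^ (n + 1) * q ^ ((n + 1) ^ 2) * (1 - q ^ (n + 1)) * h2

/-- Finite form of Gauss's identity for `∑ q ^ (k * (k + 1) / 2)`. -/
theorem sum_pow_triangular_mul_prod (q : A) (G : ℕ → A)
    (hG : ∀ i, G i * (1 - q ^ (2 * i + 2)) = 1) (n : ℕ) :
    (∑ k ∈ range (2 * n), q ^ (k * (k + 1) / 2)) *
        ∏ i ∈ range n, (1 - q ^ (2 * i + 1)) * G i =
      ∑ s ∈ range n, (∏ i ∈ range s, (1 - q ^ (2 * i + 1)) * G i) * q ^ (s * (2 * n + 1)) := by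
  set R : ℕ → A := fun n => ∏ i ∈ range n, (1 - q ^ (2 * i + 1)) * G i with hR
  have hR1 (s : ℕ) : R (s + 1) = R s * ((1 - q ^ (2 * s + 1)) * G s) := by
    simp only [hR, prod_range_succ]
  have telescope (x : A) (n : ℕ) :
      (1 - q * x) * ∑ s ∈ range n, R s * (x ^ s * q ^ (2 * s)) =
        (1 - x) * ∑ s ∈ range n, R s * x ^ s + x ^ n * (R n * (1 - q ^ (2 * n))) := by
    induction n with
    | zero => simp
    | succ n ih =>
      rw [sum_range_succ, sum_range_succ, mul_add, mul_add, ih, hR1]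
      linear_combination (- x ^ (n + 1) * R n * (1 - q ^ (2 * n + 1))) * hG n
  change _ * R n = ∑ s ∈ range n, R s * q ^ (s * (2 * n + 1))
  induction n with
  | zero => simp
  | succ n ih =>
    have hu : IsUnit (1 - q ^ (2 * n + 2)) := IsUnit.of_mul_eq_one_right _ (hG n)
    apply hu.mul_left_cancel
    have e1 : ∑ s ∈ range (n + 1), R s * q ^ (s * (2 * (n + 1) + 1)) =
        ∑ s ∈ range (n + 1), R s * ((q ^ (2 * n + 1)) ^ s * q ^ (2 * s)) := by
      refine sum_congr rfl fun s _ => ?_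
      ring
    have e2 : ∑ s ∈ range n, R s * q ^ (s * (2 * n + 1)) =
        ∑ s ∈ range n, R s * (q ^ (2 * n + 1)) ^ s := by
      refine sum_congr rfl fun s _ => ?_
      ring
    have e0 : 1 - q ^ (2 * n + 2) = 1 - q * q ^ (2 * n + 1) := by ring
    have t1 : 2 * n * (2 * n + 1) / 2 = n * (2 * n + 1) := by
      rw [mul_assoc, Nat.mul_div_cancel_left _ two_pos]
    have t2 : (2 * n + 1) * (2 * n + 1 + 1) / 2 = (2 * n + 1) * (n + 1) := by
      rw [show (2 * n + 1) * (2 * n + 1 + 1) = 2 * ((2 * n + 1) * (n + 1)) by ring,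
        Nat.mul_div_cancel_left _ two_pos]
    rw [e1, sum_range_succ _ n, mul_add (1 - q ^ (2 * n + 2)), e0, telescope, ← e2, ← ih, hR1,
      show 2 * (n + 1) = 2 * n + 1 + 1 by ring, sum_range_succ, sum_range_succ, t1, t2]
    have e3 : (q ^ (2 * n + 1)) ^ n = q ^ (n * (2 * n + 1)) := by ring
    have e4 : q ^ ((2 * n + 1) * (n + 1)) = q ^ (n * (2 * n + 1)) * q ^ (2 * n + 1) := by ring
    rw [e3, e4]
    linear_combination (∑ k ∈ range (2 * n), q ^ (k * (k + 1) / 2) +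
      q ^ (n * (2 * n + 1)) + q ^ (n * (2 * n + 1)) * q ^ (2 * n + 1)) * R n *
      (1 - q ^ (2 * n + 1)) * hG n

end FiniteIdentities

section FiberSeries

variable (R : Type*) [CommRing R] {ι κ : Type*}

/-- The power series whose `m`-th coefficient counts the indices of weight `m`; informally
`∑ i, X ^ w i`. -/
noncomputable def fiberSeries (w : ι → ℕ) : R⟦X⟧ :=
  PowerSeries.mk fun m => (Nat.card {i // w i = m} : R)

theorem coeff_fiberSeries (w : ι → ℕ) (m : ℕ) :
    coeff m (fiberSeries R w) = (Nat.card {i // w i = m} : R) := coeff_mk _ _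

theorem fiberSeries_eq_add {σ : Type*} (e : ι ⊕ κ ≃ σ) (w : σ → ℕ)
    (hw : ∀ m, Finite {i // w i = m}) :
    fiberSeries R w =
      fiberSeries R (fun i => w (e (Sum.inl i))) + fiberSeries R (fun k => w (e (Sum.inr k))) := by
  ext m
  have e' : {i // w i = m} ≃ {i // w (e (Sum.inl i)) = m} ⊕ {k // w (e (Sum.inr k)) = m} :=
    (e.subtypeEquiv fun _ => Iff.rfl).symm.trans (Equiv.subtypeSum (p := fun i => w (e i) = m))
  have := hw m
  have : Finite ({i // w (e (Sum.inl i)) = m} ⊕ {k // w (e (Sum.inr k)) = m}) :=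
    Finite.of_equiv _ e'
  have := Finite.sum_left {k // w (e (Sum.inr k)) = m} (α := {i // w (e (Sum.inl i)) = m})
  have := Finite.sum_right {i // w (e (Sum.inl i)) = m} (β := {k // w (e (Sum.inr k)) = m})
  rw [map_add, coeff_fiberSeries, coeff_fiberSeries, coeff_fiberSeries, Nat.card_congr e',
    Nat.card_sum, Nat.cast_add]

/-- The fiber of a sum of weights, decomposed according to the values of both summands. -/
def fiberAddEquiv (w : ι → ℕ) (v : κ → ℕ) (m : ℕ) : {p : ι × κ // w p.1 + v p.2 = m} ≃
    Σ a : antidiagonal m, {i // w i = a.1.1} × {k // v k = a.1.2} where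
  toFun p := ⟨⟨(w p.1.1, v p.1.2), mem_antidiagonal.2 p.2⟩, ⟨p.1.1, rfl⟩, ⟨p.1.2, rfl⟩⟩
  invFun s := ⟨(s.2.1.1, s.2.2.1), by
    rw [s.2.1.2, s.2.2.2]; exact mem_antidiagonal.1 s.1.2⟩
  left_inv _ := rfl
  right_inv := by
    rintro ⟨⟨⟨a, b⟩, h⟩, ⟨i, hi⟩, ⟨k, hk⟩⟩
    dsimp only at hi hk
    subst hi hk
    rfl

theorem finite_fiber_add {w : ι → ℕ} {v : κ → ℕ} (hw : ∀ m, Finite {i // w i = m})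
    (hv : ∀ m, Finite {k // v k = m}) (m : ℕ) : Finite {p : ι × κ // w p.1 + v p.2 = m} :=
  Finite.of_equiv _ (fiberAddEquiv w v m).symm

theorem finite_fiber_mul {w : ι → ℕ} (hw : ∀ m, Finite {i // w i = m}) {d : ℕ} (hd : 0 < d)
    (m : ℕ) : Finite {i // d * w i = m} :=
  Finite.of_injective
    (fun k : {i // d * w i = m} => (⟨k.1, Nat.eq_div_of_mul_eq_right hd.ne' k.2⟩ :
      {i // w i = m / d}))
    fun _ _ h => Subtype.ext (by simpa using h)

theorem coeff_fiberSeries_mul (w : ι → ℕ) (v : κ → ℕ) (hw : ∀ m, Finite {i // w i = m})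
    (hv : ∀ m, Finite {k // v k = m}) (m : ℕ) :
    coeff m (fiberSeries R w * fiberSeries R v) =
      (Nat.card {p : ι × κ // w p.1 + v p.2 = m} : R) := by
  rw [Nat.card_congr (fiberAddEquiv w v m), Nat.card_sigma, coeff_mul, Nat.cast_sum,
    ← sum_coe_sort]
  refine sum_congr rfl fun a _ => ?_
  rw [coeff_fiberSeries, coeff_fiberSeries, Nat.card_prod, Nat.cast_mul]

theorem expand_fiberSeries (d : ℕ) (hd : d ≠ 0) (w : ι → ℕ) :
    expand d hd (fiberSeries R w) = fiberSeries R fun i => d * w i := by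
  ext m
  rw [coeff_expand, coeff_fiberSeries, coeff_fiberSeries]
  split_ifs with h
  · obtain ⟨k, rfl⟩ := h
    simp [Nat.mul_div_cancel_left _ (Nat.pos_of_ne_zero hd), hd]
  · have : IsEmpty {i // d * w i = m} := ⟨fun i => h ⟨_, i.2.symm⟩⟩
    simp

theorem X_pow_mul_fiberSeries (d : ℕ) (w : ι → ℕ) :
    X ^ d * fiberSeries R w = fiberSeries R fun i => w i + d := by
  ext m
  rw [coeff_X_pow_mul', coeff_fiberSeries, coeff_fiberSeries]
  split_ifs with h
  · obtain ⟨k, rfl⟩ := Nat.exists_eq_add_of_le' h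
    simp
  · have : IsEmpty {i // w i + d = m} := ⟨fun i => h (by have := i.2; omega)⟩
    simp

theorem coeff_X_pow_mul_expand (d r : ℕ) (hd : d ≠ 0) (f : R⟦X⟧) (n s : ℕ) (hr : r < d)
    (hs : s < d) :
    coeff (d * n + s) (X ^ r * expand d hd f) = if r = s then coeff n f else 0 := by
  rw [coeff_X_pow_mul', coeff_expand]
  split_ifs with h1 h2 h3 h3 h3
  · subst h3
    rw [Nat.add_sub_cancel, Nat.mul_div_cancel_left _ (Nat.pos_of_ne_zero hd)]
  · have h4 := (Nat.modEq_iff_dvd' h1).2 h2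
    rw [Nat.ModEq, Nat.mul_add_mod, Nat.mod_eq_of_lt hs, Nat.mod_eq_of_lt hr] at h4
    exact absurd h4 h3
  · subst h3
    simp at h2
  · rfl
  · omega
  · rfl

theorem finite_fiber_nat {w : ℕ → ℕ} (hw : ∀ k, k ≤ w k) (m : ℕ) : Finite {k // w k = m} :=
  ((Set.finite_Iic m).subset fun k (hk : w k = m) => hk ▸ hw k).to_subtype

theorem finite_fiber_int {w : ℤ → ℕ} (hw : ∀ k, k.natAbs ≤ w k + 1) (m : ℕ) :
    Finite {k // w k = m} :=
  ((Set.finite_Icc (-(m + 1) : ℤ) (m + 1)).subset fun k (hk : w k = m) => by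
    have := hw k
    rw [Set.mem_Icc]
    omega).to_subtype

theorem coeff_sum_X_pow {w : ℕ → ℕ} (hw : ∀ k, k ≤ w k) {m n : ℕ} (h : m < n) :
    coeff m (∑ k ∈ range n, (X : R⟦X⟧) ^ w k) = coeff m (fiberSeries R w) := by
  have e : {k // w k = m} ≃ {k // k ∈ (range n).filter (w · = m)} :=
    Equiv.subtypeEquivRight fun k => by
      have := hw k
      simp only [mem_filter, mem_range]
      omega
  rw [coeff_fiberSeries, Nat.card_congr e, Nat.card_eq_fintype_card, Fintype.card_coe, map_sum,
    card_filter, Nat.cast_sum]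
  refine sum_congr rfl fun k _ => ?_
  rw [coeff_X_pow]
  simp [eq_comm]

end FiberSeries

section GeneratingFunctions

open Filter Topology PowerSeries.WithPiTopology

theorem mk_pbar_eq_mul (K : Type*) [CommRing K] :
    (PowerSeries.mk fun n => (pbar n : K)) =
      (PowerSeries.mk fun n => (#(Nat.Partition.countRestricted n 2) : K)) *
        PowerSeries.mk fun n => (#(Nat.Partition.restricted n fun _ => True) : K) := by
  ext n
  simp [coeff_mul, Nat.sum_antidiagonal_eq_sum_range_succ_mk, pbar,
    Nat.Partition.countRestricted_two, Nat.Partition.restricted]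

theorem mk_pod_eq_genFun (K : Type*) [CommRing K] :
    (PowerSeries.mk fun n => (pod n : K)) =
      Nat.Partition.genFun fun i c => if Odd i → c ≤ 1 then (1 : K) else 0 := by
  classical
  ext n
  rw [coeff_mk, Nat.Partition.coeff_genFun, pod, Nat.card_eq_fintype_card, Fintype.card_subtype,
    card_filter, Nat.cast_sum]
  refine sum_congr rfl fun p _ => ?_
  rw [Finsupp.prod, prod_boole]
  simp only [Multiset.toFinsupp_support, Multiset.mem_toFinset, Multiset.toFinsupp_apply]
  rw [Nat.cast_ite, Nat.cast_one, Nat.cast_zero]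
  refine if_congr ⟨fun h i _ => h i, fun h i hi => ?_⟩ rfl rfl
  by_cases hp : i ∈ p.parts
  · exact h i hp hi
  · simp [Multiset.count_eq_zero_of_notMem hp]

variable (K : Type*) [CommRing K] [TopologicalSpace K]

theorem tendsto_rescale_sum_X_pow {w : ℕ → ℕ} (hw : ∀ k, k ≤ w k) (a : K) :
    Tendsto (fun n => rescale a (∑ k ∈ range n, (X : K⟦X⟧) ^ w k)) atTop
      (𝓝 (rescale a (fiberSeries K w))) := by
  rw [tendsto_iff_coeff_tendsto]
  refine fun d => tendsto_atTop_of_eventually_const (i₀ := d + 1) fun n hn => ?_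
  rw [coeff_rescale, coeff_rescale, coeff_sum_X_pow K hw hn]

theorem tendsto_one_add_X_pow_mul {w : ℕ → ℕ} (hw : ∀ k, k ≤ w k) (f : ℕ → K⟦X⟧) :
    Tendsto (fun n => 1 + X ^ (w n + 1) * f n) atTop (𝓝 1) := by
  rw [tendsto_iff_coeff_tendsto]
  refine fun d => tendsto_atTop_of_eventually_const (i₀ := d) fun n hn => ?_
  have := hw n
  rw [map_add, coeff_X_pow_mul', if_neg (by omega), add_zero]

theorem mk_pbar_mul_rescale [T2Space K] [IsTopologicalRing K] :
    (PowerSeries.mk fun n => (pbar n : K)) *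
      (1 + 2 * rescale (-1) (fiberSeries K fun k : ℕ => (k + 1) ^ 2)) = 1 := by
  set G : ℕ → K⟦X⟧ := fun i => ∑' j : ℕ, (X ^ (i + 1)) ^ j with hGdef
  have hG (i : ℕ) : G i * (1 - X ^ (i + 1)) = 1 :=
    tsum_pow_mul_one_sub_of_constantCoeff_eq_zero (by simp)
  have h1 := ((Nat.Partition.hasProd_powerSeriesMk_card_countRestricted K two_pos).mul
    (Nat.Partition.hasProd_powerSeriesMk_card_restricted K fun _ => True)).tendsto_prod_nat
  rw [← mk_pbar_eq_mul] at h1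
  have hw (k : ℕ) : k ≤ (k + 1) ^ 2 := by nlinarith
  have h2 := ((tendsto_rescale_sum_X_pow K hw (-1)).const_mul 2).const_add 1
  refine tendsto_nhds_unique (h1.mul h2) ?_
  refine (tendsto_one_add_X_pow_mul K (w := id) (fun k => le_rfl) fun n =>
    ∑ s ∈ range n, (-1) ^ (s + 1) * (∏ i ∈ range (s + 1), (1 + X ^ i) * G i) *
      X ^ (s * (n + 1))).congr fun n => ?_
  have key := sum_neg_one_pow_mul_pow_sq_mul_prod (X : K⟦X⟧) G hG n
  have e1 : rescale (-1) (∑ k ∈ range n, (X : K⟦X⟧) ^ (k + 1) ^ 2) =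
      ∑ k ∈ range n, (-1) ^ (k + 1) * X ^ ((k + 1) ^ 2) := by
    rw [map_sum]
    refine sum_congr rfl fun k _ => ?_
    rw [map_pow, rescale_neg_one_X, neg_pow]
    congr 1
    rcases Nat.even_or_odd (k + 1) with h | h
    · rw [h.neg_one_pow, (h.pow_of_ne_zero two_ne_zero).neg_one_pow]
    · rw [h.neg_one_pow, h.pow.neg_one_pow]
  have e2 : ∏ i ∈ range n, ((∑ j ∈ range 2, (X : K⟦X⟧) ^ ((i + 1) * j)) *
      if True then ∑' j : ℕ, X ^ ((i + 1) * j) else 1) =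
      ∏ i ∈ range n, (1 + X ^ (i + 1)) * G i := by
    refine prod_congr rfl fun i _ => ?_
    simp [sum_range_succ, hGdef, pow_mul]
  rw [e1, e2, mul_comm (∏ i ∈ range n, (1 + X ^ (i + 1)) * G i), key, sum_range_succ', mul_sum,
    add_comm]
  congr 1
  · refine sum_congr rfl fun s _ => ?_
    simp only [id]
    ring
  · simp

theorem mk_pod_mul_rescale [T2Space K] [IsTopologicalRing K] :
    (PowerSeries.mk fun n => (pod n : K)) *
      rescale (-1) (fiberSeries K fun k : ℕ => k * (k + 1) / 2) = 1 := by
  set G : ℕ → K⟦X⟧ := fun i => ∑' j : ℕ, (X ^ (2 * i + 2)) ^ j with hGdef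
  have hG (i : ℕ) : G i * (1 - (-X) ^ (2 * i + 2)) = 1 := by
    rw [(show Even (2 * i + 2) from ⟨i + 1, by ring⟩).neg_pow]
    exact tsum_pow_mul_one_sub_of_constantCoeff_eq_zero (by simp)
  have h1 := (Nat.Partition.hasProd_genFun
    fun i c => if Odd i → c ≤ 1 then (1 : K) else 0).tendsto_prod_nat
  rw [← mk_pod_eq_genFun] at h1
  have hw (k : ℕ) : k ≤ k * (k + 1) / 2 := by
    rw [Nat.le_div_iff_mul_le two_pos]
    rcases k with _ | k <;> nlinarith
  have ht : Tendsto (fun n : ℕ => 2 * (n + 1)) atTop atTop :=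
    tendsto_atTop_mono (fun n => by dsimp only [id]; omega) tendsto_id
  refine tendsto_nhds_unique ((h1.comp ht).mul ((tendsto_rescale_sum_X_pow K hw (-1)).comp ht)) ?_
  refine (tendsto_one_add_X_pow_mul K (w := fun n => 2 * n + 2) (fun k => by omega) fun n =>
    ∑ s ∈ range n, (∏ i ∈ range (s + 1), (1 - (-X) ^ (2 * i + 1)) * G i) *
      (- (-X) ^ (s * (2 * n + 3)))).congr fun n => ?_
  have key := sum_pow_triangular_mul_prod (-X : K⟦X⟧) G hG (n + 1)
  have e2 (n : ℕ) : ∏ i ∈ range (2 * n), (1 + ∑' j,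
      (if Odd (i + 1) → j + 1 ≤ 1 then (1 : K) else 0) • (X : K⟦X⟧) ^ ((i + 1) * (j + 1))) =
        ∏ i ∈ range n, (1 - (-X) ^ (2 * i + 1)) * G i := by
    induction n with
    | zero => simp
    | succ n ih =>
      rw [show 2 * (n + 1) = 2 * n + 1 + 1 by ring, prod_range_succ, prod_range_succ, ih,
        prod_range_succ _ n, mul_assoc]
      congr 2
      · have ho : Odd (2 * n + 1) := ⟨n, rfl⟩
        rw [ho.neg_pow, tsum_eq_single 0 fun j hj => by simp [ho, hj]]
        simp
      · have ho : ¬ Odd (2 * n + 1 + 1) := by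
          rw [Nat.not_odd_iff_even]
          exact ⟨n + 1, by ring⟩
        have hs : Summable fun j : ℕ => ((X : K⟦X⟧) ^ (2 * n + 2)) ^ j :=
          summable_pow_of_constantCoeff_eq_zero (by simp)
        rw [hGdef]
        simp only [ho, false_imp_iff, if_true, one_smul]
        rw [hs.tsum_eq_zero_add]
        simp [pow_mul]
  simp only [Function.comp_apply]
  rw [e2, mul_comm (∏ i ∈ range (n + 1), (1 - (-X) ^ (2 * i + 1)) * G i), map_sum]
  simp only [map_pow, rescale_neg_one_X]
  rw [key, sum_range_succ', mul_sum, add_comm]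
  congr 1
  · refine sum_congr rfl fun s _ => ?_
    have : (X : K⟦X⟧) ^ (2 * n + 3) = - (-X) ^ (2 * n + 3) := by
      rw [(show Odd (2 * n + 3) from ⟨n + 1, by ring⟩).neg_pow, neg_neg]
    rw [show 2 * n + 2 + 1 = 2 * n + 3 by ring, this]
    ring
  · simp

end GeneratingFunctions

section ThetaSeries

variable (R : Type*) [CommRing R]

/-- Ramanujan's theta function `φ(q) = ∑_{k ∈ ℤ} q ^ (k ^ 2)`. -/
noncomputable def thetaPhi : R⟦X⟧ := fiberSeries R fun k : ℤ => (k ^ 2).toNat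

/-- Ramanujan's theta function `ψ(q) = ∑_{k ≥ 0} q ^ (k * (k + 1) / 2)`. -/
noncomputable def thetaPsi : R⟦X⟧ := fiberSeries R fun k : ℕ => k * (k + 1) / 2

theorem finite_fiber_sq (m : ℕ) : Finite {k : ℤ // (k ^ 2).toNat = m} :=
  finite_fiber_int (fun k => by
    have h1 : k ≤ k ^ 2 := Int.le_self_sq k
    have h2 : -k ≤ (-k) ^ 2 := Int.le_self_sq (-k)
    rw [neg_sq] at h2
    omega) m

theorem two_mul_triangular (k : ℤ) : 2 * ((k * (k + 1) / 2).toNat : ℤ) = k * (k + 1) := by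
  obtain ⟨c, hc⟩ := Int.even_mul_succ_self k
  have : 0 ≤ k * (k + 1) := by nlinarith [Int.le_self_sq (-k), Int.le_self_sq k]
  omega

theorem finite_fiber_triangular (m : ℕ) : Finite {k : ℤ // (k * (k + 1) / 2).toNat = m} :=
  finite_fiber_int (fun k => by
    have h := two_mul_triangular k
    have h1 : k ≤ (k * (k + 1) / 2).toNat + 1 := by nlinarith [sq_nonneg (2 * k - 1)]
    have h2 : -k ≤ (k * (k + 1) / 2).toNat + 1 := by nlinarith [sq_nonneg (2 * k + 3)]
    omega) m

theorem thetaPhi_eq_one_add :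
    thetaPhi R = 1 + 2 * fiberSeries R fun k : ℕ => (k + 1) ^ 2 := by
  have hf (m : ℕ) : Finite {k : ℕ // k ^ 2 = m} :=
    finite_fiber_nat (fun k => Nat.le_self_pow two_ne_zero k) m
  have h1 : fiberSeries R (fun _ : Unit => 0) = 1 := by
    ext m
    rw [coeff_fiberSeries, coeff_one]
    split_ifs with h
    · simp [h]
    · simp [Ne.symm h]
  have h2 := fiberSeries_eq_add R Equiv.natSumPUnitEquivNat.{0} (fun k : ℕ => k ^ 2) hf
  have e1 (k : ℕ) : (((k : ℕ) : ℤ) ^ 2).toNat = k ^ 2 := by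
    rw [← Nat.cast_pow, Int.toNat_natCast]
  have e2 (k : ℕ) : ((Int.negSucc k) ^ 2).toNat = (k + 1) ^ 2 := by
    rw [Int.negSucc_eq, neg_sq, ← Nat.cast_succ, e1]
  rw [thetaPhi, fiberSeries_eq_add R Equiv.intEquivNatSumNat.symm _ finite_fiber_sq]
  change fiberSeries R (fun k : ℕ => ((k : ℤ) ^ 2).toNat) +
    fiberSeries R (fun k : ℕ => ((Int.negSucc k) ^ 2).toNat) = _
  change _ = fiberSeries R (fun k : ℕ => (k + 1) ^ 2) + fiberSeries R (fun _ : Unit => 0) at h2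
  simp only [e1, e2]
  rw [h2, h1]
  ring

theorem fiberSeries_int_triangular :
    fiberSeries R (fun k : ℤ => (k * (k + 1) / 2).toNat) = 2 * thetaPsi R := by
  have e1 (k : ℕ) : (((k : ℕ) : ℤ) * (k + 1) / 2).toNat = k * (k + 1) / 2 := by
    rw [← Nat.cast_succ, ← Nat.cast_mul]
    exact Int.toNat_natCast _
  have e2 (k : ℕ) : ((Int.negSucc k) * (Int.negSucc k + 1) / 2).toNat = k * (k + 1) / 2 := by
    rw [← e1, Int.negSucc_eq]
    ring_nf
  rw [thetaPsi, fiberSeries_eq_add R Equiv.intEquivNatSumNat.symm _ finite_fiber_triangular]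
  change fiberSeries R (fun k : ℕ => ((k : ℤ) * (k + 1) / 2).toNat) +
    fiberSeries R (fun k : ℕ => ((Int.negSucc k) * (Int.negSucc k + 1) / 2).toNat) = _
  simp only [e1, e2]
  ring

theorem thetaPhi_eq_expand_four_add :
    thetaPhi R = expand 4 four_ne_zero (thetaPhi R) +
      X * expand 8 (by norm_num) (2 * thetaPsi R) := by
  let e : ℤ ⊕ ℤ ≃ ℤ := Equiv.ofBijective (Sum.elim (fun k => 2 * k) fun k => 2 * k + 1) <| by
    constructor
    · rintro (a | a) (b | b) h <;> simp only [Sum.elim_inl, Sum.elim_inr] at h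
      · exact congrArg Sum.inl (by omega)
      · omega
      · omega
      · exact congrArg Sum.inr (by omega)
    · intro k
      obtain ⟨c, rfl | rfl⟩ := Int.even_or_odd' k
      · exact ⟨Sum.inl c, rfl⟩
      · exact ⟨Sum.inr c, rfl⟩
  have h := fiberSeries_eq_add R e _ finite_fiber_sq
  have e1 (k : ℤ) : ((e (Sum.inl k)) ^ 2).toNat = 4 * (k ^ 2).toNat := by
    change ((2 * k) ^ 2).toNat = _
    rw [mul_pow]
    have := sq_nonneg k
    omega
  have e2 (k : ℤ) : ((e (Sum.inr k)) ^ 2).toNat = 8 * (k * (k + 1) / 2).toNat + 1 := by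
    change ((2 * k + 1) ^ 2).toNat = _
    have := two_mul_triangular k
    rw [show (2 * k + 1) ^ 2 = 4 * (k * (k + 1)) + 1 by ring]
    omega
  simp only [e1, e2] at h
  rw [← fiberSeries_int_triangular, ← pow_one X, expand_fiberSeries, X_pow_mul_fiberSeries]
  nth_rw 2 [thetaPhi]
  rw [expand_fiberSeries]
  exact h

/-- Splitting of `thetaPhi` into exponents `0` and `1` modulo `3`. -/
theorem exists_thetaPhi_eq_expand_add :
    ∃ g : R⟦X⟧, thetaPhi R = expand 3 three_ne_zero (expand 3 three_ne_zero (thetaPhi R)) +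
      X * expand 3 three_ne_zero g := by
  refine ⟨PowerSeries.mk fun n => coeff (3 * n + 1) (thetaPhi R), ?_⟩
  ext m
  obtain ⟨n, s, hs, rfl⟩ : ∃ n s, s < 3 ∧ m = 3 * n + s :=
    ⟨m / 3, m % 3, Nat.mod_lt _ three_pos, (Nat.div_add_mod m 3).symm⟩
  rw [map_add, ← pow_one (X : R⟦X⟧), ← one_mul (expand 3 _ (expand 3 _ _)), ← pow_zero (X : R⟦X⟧),
    coeff_X_pow_mul_expand R 3 0 three_ne_zero _ _ _ three_pos hs,
    coeff_X_pow_mul_expand R 3 1 three_ne_zero _ _ _ (by norm_num) hs]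
  interval_cases s
  · rw [if_pos rfl, if_neg (by norm_num), add_zero, thetaPhi, expand_fiberSeries,
      coeff_fiberSeries, coeff_fiberSeries, add_zero]
    congr 1
    refine (Nat.card_congr (Equiv.ofBijective (fun k => ⟨3 * k.1, by
      have h := k.2
      rw [mul_pow]
      have := sq_nonneg k.1
      omega⟩)
      ⟨?_, ?_⟩)).symm
    · intro a b h
      have := congrArg Subtype.val h
      exact Subtype.ext (by simpa using this)
    · rintro ⟨k, hk⟩
      have h0 := sq_nonneg k
      have : (3 : ℤ) ∣ k := Int.prime_three.dvd_of_dvd_pow (n := 2) (by omega)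
      obtain ⟨j, rfl⟩ := this
      refine ⟨⟨j, ?_⟩, rfl⟩
      rw [mul_pow] at hk h0
      omega
  · rw [if_neg (by norm_num), if_pos rfl, coeff_mk, zero_add]
  · rw [if_neg (by norm_num), if_neg (by norm_num), thetaPhi, coeff_fiberSeries, add_zero]
    have : IsEmpty {k : ℤ // (k ^ 2).toNat = 3 * n + 2} := ⟨fun ⟨k, hk⟩ => by
      have h0 : k ^ 2 = 3 * n + 2 := by omega
      have h1 : k % 3 = 0 ∨ k % 3 = 1 ∨ k % 3 = 2 := by omega
      have h2 : k ^ 2 % 3 = 2 := by omega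
      rcases h1 with h | h | h <;> simp [pow_two, Int.mul_emod, h] at h2⟩
    simp

/-- Splitting of `thetaPsi` into exponents `0` and `1` modulo `3`. -/
theorem exists_thetaPsi_eq_expand_add :
    ∃ g : R⟦X⟧, thetaPsi R = expand 3 three_ne_zero g +
      X * expand 3 three_ne_zero (expand 3 three_ne_zero (thetaPsi R)) := by
  refine ⟨PowerSeries.mk fun n => coeff (3 * n) (thetaPsi R), ?_⟩
  ext m
  obtain ⟨n, s, hs, rfl⟩ : ∃ n s, s < 3 ∧ m = 3 * n + s :=
    ⟨m / 3, m % 3, Nat.mod_lt _ three_pos, (Nat.div_add_mod m 3).symm⟩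
  rw [map_add, ← pow_one (X : R⟦X⟧), ← one_mul (expand 3 _ (PowerSeries.mk _)),
    ← pow_zero (X : R⟦X⟧), coeff_X_pow_mul_expand R 3 0 three_ne_zero _ _ _ three_pos hs,
    coeff_X_pow_mul_expand R 3 1 three_ne_zero _ _ _ (by norm_num) hs]
  have htri (k : ℕ) : 2 * (k * (k + 1) / 2) = k * (k + 1) :=
    Nat.two_mul_div_two_of_even (Nat.even_mul_succ_self k)
  have hmod (k : ℕ) : ∃ j, k = 3 * j ∨ k = 3 * j + 1 ∨ k = 3 * j + 2 := ⟨k / 3, by omega⟩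
  interval_cases s
  · rw [if_pos rfl, if_neg (by norm_num), coeff_mk, add_zero, add_zero]
  · rw [if_neg (by norm_num), if_pos rfl, zero_add, thetaPsi, expand_fiberSeries,
      coeff_fiberSeries, coeff_fiberSeries]
    congr 1
    refine (Nat.card_congr (Equiv.ofBijective (fun k => ⟨3 * k.1 + 1, by
      have h := k.2
      have h1 := htri k.1
      have h2 := htri (3 * k.1 + 1)
      ring_nf at h h1 h2 ⊢
      omega⟩)
      ⟨?_, ?_⟩)).symm
    · intro a b h
      have := congrArg Subtype.val h
      exact Subtype.ext (by simpa using this)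
    · rintro ⟨k, hk⟩
      have h1 := htri k
      rw [hk] at h1
      obtain ⟨j, rfl | rfl | rfl⟩ := hmod k
      · ring_nf at h1; omega
      · refine ⟨⟨j, ?_⟩, rfl⟩
        have h2 := htri j
        ring_nf at h1 h2 ⊢
        omega
      · ring_nf at h1; omega
  · rw [if_neg (by norm_num), if_neg (by norm_num), thetaPsi, coeff_fiberSeries, add_zero]
    have : IsEmpty {k : ℕ // k * (k + 1) / 2 = 3 * n + 2} := ⟨fun ⟨k, hk⟩ => by
      have h1 := htri k
      rw [hk] at h1
      obtain ⟨j, rfl | rfl | rfl⟩ := hmod k <;> ring_nf at h1 <;> omega⟩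
    simp

end ThetaSeries

/-- The number of representations of `4 * m ≠ 0` by `x ^ 2 + 3 * y ^ 2` is divisible by `3`: the
map `(x, y) ↦ ((-x - 3 * y) / 2, (x - y) / 2)` permutes them without fixed points, and its cube is
the identity. -/
theorem three_dvd_card_sq_add_three_mul_sq {m : ℤ} (hm : m ≠ 0) :
    3 ∣ Nat.card {p : ℤ × ℤ // p.1 ^ 2 + 3 * p.2 ^ 2 = 4 * m} := by
  have hfin : Finite {p : ℤ × ℤ // p.1 ^ 2 + 3 * p.2 ^ 2 = 4 * m} := by
    refine ((Set.finite_Icc (-(4 * m)) (4 * m) |>.prod (Set.finite_Icc (-(4 * m)) (4 * m))).subset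
      ?_).to_subtype
    rintro ⟨x, y⟩ (h : x ^ 2 + 3 * y ^ 2 = 4 * m)
    simp only [Set.mem_prod, Set.mem_Icc]
    have := Int.le_self_sq x
    have := Int.le_self_sq y
    have := Int.le_self_sq (-x)
    have := Int.le_self_sq (-y)
    refine ⟨⟨?_, ?_⟩, ?_, ?_⟩ <;> nlinarith [sq_nonneg x, sq_nonneg y]
  have := Fintype.ofFinite {p : ℤ × ℤ // p.1 ^ 2 + 3 * p.2 ^ 2 = 4 * m}
  have hpar {x y : ℤ} (h : x ^ 2 + 3 * y ^ 2 = 4 * m) :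
      2 * ((-x - 3 * y) / 2) = -x - 3 * y ∧ 2 * ((x - y) / 2) = x - y := by
    have h2 : Even (x - y) := by
      have : Even (x ^ 2 + 3 * y ^ 2) := ⟨2 * m, by rw [h]; ring⟩
      simpa [Int.even_add, Int.even_sub, Int.even_mul, Int.even_pow, show ¬ Even (3 : ℤ) by decide]
        using this
    obtain ⟨c, hc⟩ := h2
    omega
  let f : Function.End {p : ℤ × ℤ // p.1 ^ 2 + 3 * p.2 ^ 2 = 4 * m} := fun p =>
    ⟨((-p.1.1 - 3 * p.1.2) / 2, (p.1.1 - p.1.2) / 2), by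
      obtain ⟨h1, h2⟩ := hpar p.2
      have h := p.2
      generalize (-p.1.1 - 3 * p.1.2) / 2 = a at *
      generalize (p.1.1 - p.1.2) / 2 = b at *
      have : 4 * (a ^ 2 + 3 * b ^ 2) = 4 * (4 * m) := by
        linear_combination 4 * h + (2 * a - p.1.1 - 3 * p.1.2) * h1 +
          3 * (2 * b + p.1.1 - p.1.2) * h2
      simpa using this⟩
  have hf : f ^ 3 ^ 1 = 1 := by
    funext p
    have e : (f ^ 3 ^ 1) p = f (f (f p)) := rfl
    rw [e]
    obtain ⟨h1, h2⟩ := hpar p.2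
    obtain ⟨h3, h4⟩ := hpar (f p).2
    apply Subtype.ext
    apply Prod.ext
    · change (-(f (f p)).1.1 - 3 * (f (f p)).1.2) / 2 = p.1.1
      change 2 * (f p).1.1 = _ at h1
      change 2 * (f p).1.2 = _ at h2
      change 2 * (f (f p)).1.1 = _ at h3
      change 2 * (f (f p)).1.2 = _ at h4
      omega
    · change ((f (f p)).1.1 - (f (f p)).1.2) / 2 = p.1.2
      change 2 * (f p).1.1 = _ at h1
      change 2 * (f p).1.2 = _ at h2
      change 2 * (f (f p)).1.1 = _ at h3
      change 2 * (f (f p)).1.2 = _ at h4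
      omega
  have : Fact (Nat.Prime 3) := ⟨Nat.prime_three⟩
  classical
  have key := Equiv.Perm.card_fixedPoints_modEq hf
  have hempty : IsEmpty f.fixedPoints := ⟨fun ⟨p, hp⟩ => by
    obtain ⟨h1, h2⟩ := hpar p.2
    have e1 : (-p.1.1 - 3 * p.1.2) / 2 = p.1.1 := congrArg (fun p => p.1.1) hp
    have e2 : (p.1.1 - p.1.2) / 2 = p.1.2 := congrArg (fun p => p.1.2) hp
    have e3 : p.1.1 = 0 := by omega
    have e4 : p.1.2 = 0 := by omega
    have := p.2
    rw [e3, e4] at this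
    apply hm
    linarith⟩
  rw [Fintype.card_eq_zero (α := f.fixedPoints)] at key
  rw [Nat.card_eq_fintype_card]
  exact (Nat.modEq_zero_iff_dvd).1 key

section ModThree

theorem pow_three_eq_expand (f : (ZMod 3)⟦X⟧) : f ^ 3 = expand 3 three_ne_zero f := by
  have h := MvPowerSeries.map_frobenius_expand 3 three_ne_zero (f := f)
  have e : frobenius (ZMod 3) 3 = RingHom.id _ := ZMod.frobenius_zmod 3
  rw [e, MvPowerSeries.map_id] at h
  exact h.symm

theorem three_eq_zero : (3 : (ZMod 3)⟦X⟧) = 0 := by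
  have h : (3 : ZMod 3) = 0 := rfl
  have := map_ofNat (C (R := ZMod 3)) 3
  rw [← this, h, map_zero]

theorem coeff_thetaPhi_pow_four_add (n : ℕ) :
    coeff (2 * n + 1) (thetaPhi (ZMod 3) ^ 4 +
      X * expand 2 two_ne_zero ((2 * thetaPsi (ZMod 3)) ^ 4)) = 0 := by
  rw [pow_succ' (thetaPhi _), pow_succ' (2 * thetaPsi _), pow_three_eq_expand, pow_three_eq_expand,
    map_mul, ← expand_mul, map_add, coeff_succ_X_mul, ← fiberSeries_int_triangular, thetaPhi]
  simp only [expand_fiberSeries]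
  have hf1 := finite_fiber_sq
  have hf2 := finite_fiber_mul hf1 three_pos
  have hf3 := finite_fiber_mul finite_fiber_triangular two_pos
  have hf4 := finite_fiber_mul finite_fiber_triangular (d := 2 * 3) (by norm_num)
  rw [coeff_fiberSeries_mul _ _ _ hf1 hf2,
    coeff_fiberSeries_mul _ _ _ hf3 hf4, ← Nat.cast_add]
  set A := {p : ℤ × ℤ // (p.1 ^ 2).toNat + 3 * (p.2 ^ 2).toNat = 2 * n + 1}
  set B := {p : ℤ × ℤ // 2 * (p.1 * (p.1 + 1) / 2).toNat +
    2 * 3 * (p.2 * (p.2 + 1) / 2).toNat = 2 * n}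
  have hA : Finite A := finite_fiber_add hf1 hf2 _
  have hB : Finite B := finite_fiber_add hf3 hf4 _
  have hm : (2 * n + 1 : ℤ) ≠ 0 := by omega
  rw [← Nat.card_sum, ZMod.natCast_eq_zero_iff]
  convert! three_dvd_card_sq_add_three_mul_sq hm using 1
  refine Nat.card_congr (Equiv.ofBijective (Sum.elim
    (fun p => ⟨(2 * p.1.1, 2 * p.1.2), ?_⟩)
    (fun p => ⟨(2 * p.1.1 + 1, 2 * p.1.2 + 1), ?_⟩)) ⟨?_, ?_⟩)
  · have h := p.2
    have h1 := sq_nonneg p.1.1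
    have h2 := sq_nonneg p.1.2
    dsimp only
    rw [mul_pow, mul_pow]
    omega
  · have h := p.2
    have h1 := two_mul_triangular p.1.1
    have h2 := two_mul_triangular p.1.2
    have h3 : p.1.1 * (p.1.1 + 1) + 3 * (p.1.2 * (p.1.2 + 1)) = 2 * n := by omega
    linear_combination 4 * h3
  · rintro (⟨⟨a, b⟩, h⟩ | ⟨⟨a, b⟩, h⟩) (⟨⟨c, d⟩, h'⟩ | ⟨⟨c, d⟩, h'⟩) e
    all_goals
      have e1 := congrArg (fun p => p.1.1) e
      have e2 := congrArg (fun p => p.1.2) e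
      simp only [Sum.elim_inl, Sum.elim_inr] at e1 e2
    · obtain rfl : a = c := by omega
      obtain rfl : b = d := by omega
      rfl
    · omega
    · omega
    · obtain rfl : a = c := by omega
      obtain rfl : b = d := by omega
      rfl
  · rintro ⟨⟨x, y⟩, h⟩
    dsimp only at h
    have hpar : Even (x - y) := by
      have : Even (x ^ 2 + 3 * y ^ 2) := ⟨2 * (2 * n + 1), by rw [h]; ring⟩
      simpa [Int.even_add, Int.even_sub, Int.even_mul, Int.even_pow,
        show ¬ Even (3 : ℤ) by decide] using this
    obtain ⟨c, hc⟩ := hpar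
    obtain ⟨a, rfl | rfl⟩ := Int.even_or_odd' x
    · obtain ⟨b, rfl⟩ : ∃ b, y = 2 * b := ⟨a - c, by omega⟩
      refine ⟨Sum.inl ⟨(a, b), ?_⟩, rfl⟩
      have h1 := sq_nonneg a
      have h2 := sq_nonneg b
      rw [mul_pow, mul_pow] at h
      dsimp only
      omega
    · obtain ⟨b, rfl⟩ : ∃ b, y = 2 * b + 1 := ⟨a - c, by omega⟩
      refine ⟨Sum.inr ⟨(a, b), ?_⟩, rfl⟩
      have h1 := two_mul_triangular a
      have h2 := two_mul_triangular b
      have h3 : a * (a + 1) + 3 * (b * (b + 1)) = 2 * n := by linarith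
      dsimp only
      omega

theorem coeff_thetaPhi_pow_five (n : ℕ) :
    coeff (8 * n + 5) (thetaPhi (ZMod 3) ^ 5) = coeff n (thetaPsi (ZMod 3) ^ 5) := by
  have h3 := three_eq_zero
  set P := thetaPhi (ZMod 3)
  set S := 2 * thetaPsi (ZMod 3) with hS
  have hP : P = expand 4 four_ne_zero P + X * expand 8 (by norm_num) S :=
    thetaPhi_eq_expand_four_add _
  set E := expand 4 four_ne_zero P
  set O := expand 8 (by norm_num) S
  obtain ⟨h, hh⟩ : ∃ h, P ^ 4 + X * expand 2 two_ne_zero (S ^ 4) = expand 2 two_ne_zero h := by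
    refine ⟨PowerSeries.mk fun n => coeff (2 * n) (P ^ 4 + X * expand 2 two_ne_zero (S ^ 4)), ?_⟩
    ext m
    rw [coeff_expand]
    split_ifs with hm
    · obtain ⟨k, rfl⟩ := hm
      rw [coeff_mk, Nat.mul_div_cancel_left _ two_pos]
    · obtain ⟨k, rfl⟩ := Nat.odd_iff.2 (Nat.two_dvd_ne_zero.1 hm)
      exact coeff_thetaPhi_pow_four_add k
  have hE4 : E ^ 4 + X ^ 4 * O ^ 4 = expand 8 (by norm_num) h := by
    have := congrArg (expand 4 four_ne_zero) hh
    rw [map_add, map_mul, expand_X, ← expand_mul, ← expand_mul, map_pow, map_pow] at this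
    exact this
  have hS5 : -4 * S ^ 5 = thetaPsi (ZMod 3) ^ 5 := by
    rw [hS]
    linear_combination -43 * thetaPsi (ZMod 3) ^ 5 * h3
  have key : P ^ 5 = X ^ 1 * expand 8 (by norm_num) (5 * S * h) +
      X ^ 5 * expand 8 (by norm_num) (-4 * S ^ 5) +
      X ^ 0 * expand 4 four_ne_zero (P ^ 5 + 5 * X * P * expand 2 two_ne_zero (S ^ 4)) +
      X ^ 2 * expand 4 four_ne_zero (10 * P ^ 3 * expand 2 two_ne_zero (S ^ 2)) +
      X ^ 3 * expand 4 four_ne_zero (10 * P ^ 2 * expand 2 two_ne_zero (S ^ 3)) := by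
    have hO (k : ℕ) : expand 4 four_ne_zero (expand 2 two_ne_zero (S ^ k)) = O ^ k := by
      rw [← expand_mul, map_pow]
    simp only [map_mul, map_add, map_pow, map_ofNat, map_neg, expand_X, ← hE4] at hO ⊢
    rw [hO, hO, hO]
    change P ^ 5 = X ^ 1 * (5 * O * (E ^ 4 + X ^ 4 * O ^ 4)) + X ^ 5 * (-4 * O ^ 5) +
      X ^ 0 * (E ^ 5 + 5 * X ^ 4 * E * O ^ 4) + X ^ 2 * (10 * E ^ 3 * O ^ 2) +
      X ^ 3 * (10 * E ^ 2 * O ^ 3)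
    rw [hP]
    ring
  rw [key, hS5, map_add, map_add, map_add, map_add]
  have h8 := fun r (hr : r < 8) f => coeff_X_pow_mul_expand (ZMod 3) 8 r (by norm_num) f n 5 hr
    (by norm_num)
  have h4 := fun r (hr : r < 4) f => coeff_X_pow_mul_expand (ZMod 3) 4 r four_ne_zero f (2 * n + 1)
    1 hr (by norm_num)
  rw [show 4 * (2 * n + 1) + 1 = 8 * n + 5 by ring] at h4
  rw [h8 1 (by norm_num), h8 5 (by norm_num), h4 0 (by norm_num), h4 2 (by norm_num),
    h4 3 (by norm_num)]
  simp

theorem coeff_three_mul_of_mul_thetaPhi_eq_one {f : (ZMod 3)⟦X⟧} (hf : f * thetaPhi (ZMod 3) = 1)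
    (n : ℕ) : coeff (3 * n) f = coeff n (thetaPhi (ZMod 3) ^ 5) := by
  obtain ⟨g, hg⟩ := exists_thetaPhi_eq_expand_add (ZMod 3)
  set P := thetaPhi (ZMod 3)
  have key : f = X ^ 0 * expand 3 three_ne_zero (P ^ 5) +
      X ^ 1 * expand 3 three_ne_zero (2 * P ^ 3 * g * f) +
      X ^ 2 * expand 3 three_ne_zero (g ^ 2 * f) := by
    have h5 : P ^ 5 = (P ^ 3) ^ 2 * f := by linear_combination -P ^ 5 * hf
    have h1 : f = P ^ 2 * f ^ 3 := by linear_combination (-f - f ^ 2 * P) * hf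
    rw [h5]
    simp only [pow_three_eq_expand, map_mul, map_pow, map_ofNat] at h1 ⊢
    nth_rw 1 [h1, hg]
    ring
  rw [key]
  simp only [map_add]
  have h3 := fun r (hr : r < 3) f => coeff_X_pow_mul_expand (ZMod 3) 3 r three_ne_zero f n 0 hr
    (by norm_num)
  rw [add_zero] at h3
  rw [h3 0 (by norm_num), h3 1 (by norm_num), h3 2 (by norm_num)]
  simp

theorem coeff_three_mul_add_two_of_mul_thetaPsi_eq_one {f : (ZMod 3)⟦X⟧}
    (hf : f * thetaPsi (ZMod 3) = 1) (n : ℕ) :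
    coeff (3 * n + 2) f = coeff n (thetaPsi (ZMod 3) ^ 5) := by
  obtain ⟨g, hg⟩ := exists_thetaPsi_eq_expand_add (ZMod 3)
  set P := thetaPsi (ZMod 3)
  have key : f = X ^ 0 * expand 3 three_ne_zero (g ^ 2 * f) +
      X ^ 1 * expand 3 three_ne_zero (2 * P ^ 3 * g * f) +
      X ^ 2 * expand 3 three_ne_zero (P ^ 5) := by
    have h5 : P ^ 5 = (P ^ 3) ^ 2 * f := by linear_combination -P ^ 5 * hf
    have h1 : f = P ^ 2 * f ^ 3 := by linear_combination (-f - f ^ 2 * P) * hf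
    rw [h5]
    simp only [pow_three_eq_expand, map_mul, map_pow, map_ofNat] at h1 ⊢
    nth_rw 1 [h1, hg]
    ring
  rw [key]
  simp only [map_add]
  have h3 := fun r (hr : r < 3) f => coeff_X_pow_mul_expand (ZMod 3) 3 r three_ne_zero f n 2 hr
    (by norm_num)
  rw [h3 0 (by norm_num), h3 1 (by norm_num), h3 2 (by norm_num)]
  simp

theorem rescale_neg_one_rescale_neg_one {R : Type*} [CommRing R] (f : R⟦X⟧) :
    rescale (-1) (rescale (-1) f) = f := by
  rw [rescale_rescale]
  simp

theorem rescale_mk_pbar_mul_thetaPhi :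
    rescale (-1) (PowerSeries.mk fun n => (pbar n : ZMod 3)) * thetaPhi (ZMod 3) = 1 := by
  let _ : TopologicalSpace (ZMod 3) := ⊥
  have _ : DiscreteTopology (ZMod 3) := ⟨rfl⟩
  have h := congrArg (rescale (-1)) (mk_pbar_mul_rescale (ZMod 3))
  rw [map_mul, map_add, map_mul, map_one, map_ofNat, rescale_neg_one_rescale_neg_one] at h
  rwa [thetaPhi_eq_one_add]

theorem rescale_mk_pod_mul_thetaPsi :
    rescale (-1) (PowerSeries.mk fun n => (pod n : ZMod 3)) * thetaPsi (ZMod 3) = 1 := by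
  let _ : TopologicalSpace (ZMod 3) := ⊥
  have _ : DiscreteTopology (ZMod 3) := ⟨rfl⟩
  have h := congrArg (rescale (-1)) (mk_pod_mul_rescale (ZMod 3))
  rw [map_mul, map_one, rescale_neg_one_rescale_neg_one] at h
  exact h

end ModThree

end PodPbar

theorem pod_pbar_congr (n : ℕ) :
    ((-1 : ℤ)) ^ (n + 1) * pod (3 * n + 2) ≡ (pbar (24 * n + 15) : ℤ) [ZMOD 3] := by
  have h1 := coeff_three_mul_of_mul_thetaPhi_eq_one rescale_mk_pbar_mul_thetaPhi (8 * n + 5)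
  have h2 := coeff_three_mul_add_two_of_mul_thetaPsi_eq_one rescale_mk_pod_mul_thetaPsi n
  rw [coeff_thetaPhi_pow_five, ← h2, PowerSeries.coeff_rescale, PowerSeries.coeff_rescale,
    PowerSeries.coeff_mk, PowerSeries.coeff_mk, show 3 * (8 * n + 5) = 24 * n + 15 by ring,
    (show Odd (24 * n + 15) from ⟨12 * n + 7, by ring⟩).neg_one_pow] at h1
  rw [show (3 : ℤ) = ((3 : ℕ) : ℤ) from rfl, ← ZMod.intCast_eq_intCast_iff]
  push_cast
  have h3 : (-1 : ZMod 3) ^ (3 * n + 2) = (-1) ^ n := by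
    rw [show 3 * n + 2 = n + 2 * (n + 1) by ring, pow_add, pow_mul]
    simp
  rw [h3] at h1
  linear_combination h1
end
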